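/- Let k be a field, A a finite-dimensional self-injective k-algebra, and M a finitely generated A-module that is a generator, self-orthogonal and Nakayama-stable. Let 0 → M → I → Ω_A^{-}(M) → 0 be exact with M → I an injective envelope, and let f : Ω_A^{-}(M) → W be a minimal left 𝒢-approximation. Then M is a projective A-module if and only if for every countable family (Z_n)_{n∈ℕ} of finitely M-filtered A-modules with Ext_A^1(W, Z_n) = 0 for all n, one has Ext_A^1(W, ⊕_n Z_n) = 0 (i.e., the class {Z : Ext_A^1(W,Z) = 0} is closed under countable direct sums of finitely M-filtered modules). (Theorem 1.2, equivalence of (1) and (5).) -/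

import Mathlib

open CategoryTheory
/-! ## Additive closure classes -/

section AddClosure

variable (A : Type) [Ring A]

/-- `X ∈ add M`: `X` is a direct summand of a finite direct sum of copies of `M`. -/
def MemAdd (M X : ModuleCat.{0} A) : Prop :=
  ∃ (n : ℕ) (Y : ModuleCat.{0} A), Nonempty ((↥X × ↥Y) ≃ₗ[A] (Fin n → ↥M))

/-- `X ∈ Add M`: `X` is a direct summand of an arbitrary direct sum of copies of `M`. -/
def MemAddBig (M X : ModuleCat.{0} A) : Prop :=
  ∃ (I : Type) (Y : ModuleCat.{0} A), Nonempty ((↥X × ↥Y) ≃ₗ[A] (I →₀ ↥M))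

/-- a morphism of `A`-modules factors through a projective module -/
def FactorsThroughProj {X Y : ModuleCat.{0} A} (f : X ⟶ Y) : Prop :=
  ∃ (P : ModuleCat.{0} A) (_ : Module.Projective A P) (g : X ⟶ P) (h : P ⟶ Y), f = g ≫ h

/-- a morphism of `A`-modules factors through a module in `Add M` -/
def FactorsThroughAddM (M : ModuleCat.{0} A) {X Y : ModuleCat.{0} A} (f : X ⟶ Y) : Prop :=
  ∃ (Z : ModuleCat.{0} A) (_ : MemAddBig A M Z) (g : X ⟶ Z) (h : Z ⟶ Y), f = g ≫ h

/-- `X ∈ add M` for unbundled modules. -/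
def MemAddPlain (M : Type) [AddCommGroup M] [Module A M]
    (X : Type) [AddCommGroup X] [Module A X] : Prop :=
  ∃ (n : ℕ) (Y : ModuleCat.{0} A), Nonempty ((X × ↥Y) ≃ₗ[A] (Fin n → M))

end AddClosure

/-! ## Ext vanishing -/

section ExtDefs

variable (A : Type) [Ring A]

/-- vanishing of `Ext^n_A(X, Y)` -/
noncomputable def extZero (n : ℕ) (X Y : ModuleCat.{0} A) : Prop :=
  Subsingleton (((Ext ℤ (ModuleCat.{0} A) n).obj (Opposite.op X)).obj Y)

/-- `M` is self-orthogonal: `Ext^n_A(M,M) = 0` for all `n ≥ 1`. -/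
noncomputable def SelfOrthogonal (M : ModuleCat.{0} A) : Prop :=
  ∀ n : ℕ, 1 ≤ n → extZero A n M M

/-- `M` is a generator for `A`-mod: `A ∈ add M`. -/
def IsGen (M : ModuleCat.{0} A) : Prop :=
  MemAdd A M (ModuleCat.of A A)

/-- membership in the `M`-Gorenstein subcategory `𝒢`:
`Ext^n_A(M,X) = 0 = Ext^n_A(X,M)` for all `n ≥ 1`. -/
noncomputable def MemG (M X : ModuleCat.{0} A) : Prop :=
  ∀ n : ℕ, 1 ≤ n → extZero A n M X ∧ extZero A n X M

end ExtDefs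

/-! ## The Nakayama functor `ν_A = D ∘ Hom_A(-, A)` -/

section Nakayama

variable (k A : Type) [Field k] [Ring A] [Algebra k A]

/-- Right multiplication by `a : A` on `Hom_A(X, A)`, as a `k`-linear map. -/
@[simps] def rmulHom (X : Type) [AddCommGroup X] [Module A X] (a : A) :
    (X →ₗ[A] A) →ₗ[k] (X →ₗ[A] A) where
  toFun f :=
    { toFun := fun x => f x * a
      map_add' := fun x y => by simp [add_mul]
      map_smul' := fun c x => by simp [mul_assoc] }
  map_add' f g := by ext x; simp [add_mul]
  map_smul' c f := by ext x; simp [Algebra.smul_def, mul_assoc]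

/-- The carrier of the Nakayama functor value `ν_A(X) = D(Hom_A(X,A))`,
where `D = Hom_k(-,k)`. -/
abbrev NuCarrier (X : Type) [AddCommGroup X] [Module A X] : Type :=
  (X →ₗ[A] A) →ₗ[k] k

/-- The left `A`-module structure on `ν_A(X) = D(Hom_A(X,A))`: `(a • φ) f = φ (f · a)`. -/
instance (X : Type) [AddCommGroup X] [Module A X] : Module A (NuCarrier k A X) where
  smul a φ := φ.comp (rmulHom k A X a)
  one_smul φ := by
    refine LinearMap.ext fun f => ?_
    exact congrArg φ (by ext x; simp)
  mul_smul a b φ := by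
    refine LinearMap.ext fun f => ?_
    exact congrArg φ (by ext x; simp [mul_assoc])
  smul_zero a := rfl
  smul_add a φ ψ := rfl
  add_smul a b φ := by
    refine LinearMap.ext fun f => ?_
    show φ ((rmulHom k A X (a + b)) f) = φ ((rmulHom k A X a) f) + φ ((rmulHom k A X b) f)
    rw [show (rmulHom k A X (a + b)) f = (rmulHom k A X a) f + (rmulHom k A X b) f from by
      ext x; simp [mul_add]]
    exact map_add φ _ _
  zero_smul φ := by
    refine LinearMap.ext fun f => ?_
    show φ ((rmulHom k A X 0) f) = 0
    rw [show (rmulHom k A X 0) f = 0 from by ext x; simp]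
    exact map_zero φ

/-- The Nakayama functor value `ν_A(X)` as an object of `ModuleCat A`. -/
noncomputable def NuMod (X : ModuleCat.{0} A) : ModuleCat.{0} A :=
  ModuleCat.of A (NuCarrier k A ↥X)

/-- `M` is Nakayama-stable: `add M = add (ν_A M)`. -/
noncomputable def NakayamaStable (M : ModuleCat.{0} A) : Prop :=
  ∀ X : ModuleCat.{0} A, MemAdd A M X ↔ MemAdd A (NuMod k A M) X

end Nakayama

/-! ## Minimal injective coresolutions, cosyzygies, `M`-filtered modules -/

section Cosyzygy

variable (A : Type) [Ring A]

/-- `ι : N ⟶ I` is an injective envelope: `I` is injective, `ι` is injective,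
and the image of `ι` is an essential submodule of `I`. -/
def IsInjEnvelope {N I : ModuleCat.{0} A} (ι : N ⟶ I) : Prop :=
  Module.Injective A ↥I ∧ Function.Injective ι ∧
    ∀ K : Submodule A ↥I, K ⊓ LinearMap.range ι.hom = ⊥ → K = ⊥

/-- `C` is the sequence of cosyzygies of `M` along a minimal injective coresolution:
`C 0 ≅ M` and for each `n` there is a short exact sequence `0 → C n → I → C (n+1) → 0`
in which `C n → I` is an injective envelope. -/
def IsMinInjCoresolution (M : ModuleCat.{0} A) (C : ℕ → ModuleCat.{0} A) : Prop :=
  Nonempty (C 0 ≅ M) ∧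
    ∀ n, ∃ (I : ModuleCat.{0} A) (ι : C n ⟶ I) (p : I ⟶ C (n + 1)),
      IsInjEnvelope A ι ∧ Function.Surjective p ∧ LinearMap.range ι.hom = LinearMap.ker p.hom

/-- the family of modules `{A} ∪ {C i | i ∈ ℕ}`, indexed by `Option ℕ`. -/
def optPick (C : ℕ → ModuleCat.{0} A) : Option ℕ → ModuleCat.{0} A
  | none => ModuleCat.of A A
  | some i => C i

/-- `Q` is isomorphic to a finite direct sum of modules from `{A} ∪ {C i | i ∈ ℕ}`. -/
def IsFinSumFrom (C : ℕ → ModuleCat.{0} A) (Q : Type) [AddCommGroup Q] [Module A Q] : Prop :=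
  ∃ (m : ℕ) (T : Fin m → Option ℕ),
    Nonempty (Q ≃ₗ[A] ((j : Fin m) → ↥(optPick A C (T j))))

/-- `X` is `M`-filtered (where `C` encodes the cosyzygies `Ω_A^{-i}(M)`, `C 0 ≅ M`):
there is an ascending chain `0 = X₀ ⊆ X₁ ⊆ ⋯` of submodules with union `X` all of whose
subquotients are finite direct sums of modules from `{A} ∪ {Ω_A^{-i}(M) | i ∈ ℕ}`. -/
def MFiltered (C : ℕ → ModuleCat.{0} A) (X : ModuleCat.{0} A) : Prop :=
  ∃ F : ℕ → Submodule A ↥X,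
    Monotone F ∧ F 0 = ⊥ ∧ (⨆ n, F n) = ⊤ ∧
      ∀ n, IsFinSumFrom A C
        (↥(F (n + 1)) ⧸ (Submodule.comap (F (n + 1)).subtype (F n)))

/-- `X` is finitely `M`-filtered: as `MFiltered`, with a chain that reaches `⊤`
after finitely many steps. -/
def FinMFiltered (C : ℕ → ModuleCat.{0} A) (X : ModuleCat.{0} A) : Prop :=
  ∃ F : ℕ → Submodule A ↥X,
    Monotone F ∧ F 0 = ⊥ ∧ (∃ n, F n = ⊤) ∧
      ∀ n, IsFinSumFrom A C
        (↥(F (n + 1)) ⧸ (Submodule.comap (F (n + 1)).subtype (F n)))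

end Cosyzygy

/-! ## Approximations -/

section Approx

variable (A : Type) [Ring A]

/-- `f : X ⟶ W` is a left `𝒢`-approximation of `X`. -/
noncomputable def IsLeftGApprox (M : ModuleCat.{0} A) {X W : ModuleCat.{0} A}
    (f : X ⟶ W) : Prop :=
  MemG A M W ∧ ∀ (G : ModuleCat.{0} A), MemG A M G → ∀ g : X ⟶ G, ∃ h : W ⟶ G, g = f ≫ h

/-- `f : X ⟶ W` is left minimal. -/
def LeftMinimal {X W : ModuleCat.{0} A} (f : X ⟶ W) : Prop :=
  ∀ α : W ⟶ W, f ≫ α = f → Function.Bijective α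

end Approx


section ExtVanishing

variable {A : Type} [Ring A]

lemma extZero_iff_subsingleton_ext (n : ℕ) (X Y : ModuleCat.{0} A) :
    extZero A (n + 1) X Y ↔ Subsingleton (Abelian.Ext X Y (n + 1)) := by
  let P := projectiveResolution X
  have h1 : extZero A (n + 1) X Y ↔
      ∀ f : P.complex.X (n + 1) ⟶ Y, P.complex.d (n + 2) (n + 1) ≫ f = 0 →
        ∃ g : P.complex.X n ⟶ Y, P.complex.d (n + 1) n ≫ g = f := by
    unfold extZero
    rw [← ModuleCat.isZero_iff_subsingleton,
      (P.isoExt (R := ℤ) (n + 1) Y).isZero_iff,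
      ← HomologicalComplex.exactAt_iff_isZero_homology,
      HomologicalComplex.exactAt_iff' _ n (n + 1) (n + 2) (by simp) (by simp),
      ShortComplex.moduleCat_exact_iff]
    rfl
  rw [h1]
  constructor
  · intro h
    refine subsingleton_of_forall_eq 0 fun x => ?_
    obtain ⟨f, hf, rfl⟩ := P.extMk_surjective x (n + 2) rfl
    exact (P.extMk_eq_zero_iff f (n + 2) rfl hf n rfl).2 (h f hf)
  · intro h f hf
    exact (P.extMk_eq_zero_iff f (n + 2) rfl hf n rfl).1 (Subsingleton.elim _ _)


section ShortExactSequence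

variable {K P X Z : Type} [AddCommGroup K] [Module A K] [AddCommGroup P] [Module A P]
  [AddCommGroup X] [Module A X] [AddCommGroup Z] [Module A Z]
  {i : K →ₗ[A] P} {p : P →ₗ[A] X}

lemma exists_shortExact_of_exact (hi : Function.Injective i) (hex : Function.Exact i p)
    (hp : Function.Surjective p) :
    ∃ w, (ShortComplex.mk (ModuleCat.ofHom i) (ModuleCat.ofHom p) w).ShortExact := by
  refine ⟨by ext x; exact hex.apply_apply_eq_zero x, ?_⟩
  refine ShortComplex.ShortExact.mk' ?_ ?_ ?_
  · rw [ShortComplex.moduleCat_exact_iff]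
    exact fun x hx => (hex x).1 hx
  · exact (ModuleCat.mono_iff_injective _).2 hi
  · exact (ModuleCat.epi_iff_surjective _).2 hp

lemma exists_extend_of_extZero (hi : Function.Injective i) (hex : Function.Exact i p)
    (hp : Function.Surjective p) (h : extZero A 1 (ModuleCat.of A X) (ModuleCat.of A Z))
    (g : K →ₗ[A] Z) : ∃ e : P →ₗ[A] Z, e ∘ₗ i = g := by
  obtain ⟨w, hS⟩ := exists_shortExact_of_exact hi hex hp
  have := (extZero_iff_subsingleton_ext 0 _ _).1 h
  obtain ⟨x, hx⟩ := Abelian.Ext.contravariant_sequence_exact₁ hS (ModuleCat.of A Z)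
    (Abelian.Ext.mk₀ (ModuleCat.ofHom g)) (n₁ := 1) rfl (Subsingleton.elim _ _)
  obtain ⟨e, rfl⟩ := (Abelian.Ext.mk₀_bijective _ _).2 x
  rw [Abelian.Ext.mk₀_comp_mk₀] at hx
  exact ⟨e.hom, congrArg ModuleCat.Hom.hom ((Abelian.Ext.mk₀_bijective _ _).1 hx)⟩

lemma exists_lift_of_extZero (hi : Function.Injective i) (hex : Function.Exact i p)
    (hp : Function.Surjective p) (h : extZero A 1 (ModuleCat.of A Z) (ModuleCat.of A K))
    (g : Z →ₗ[A] X) : ∃ e : Z →ₗ[A] P, p ∘ₗ e = g := by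
  obtain ⟨w, hS⟩ := exists_shortExact_of_exact hi hex hp
  have := (extZero_iff_subsingleton_ext 0 _ _).1 h
  obtain ⟨x, hx⟩ := Abelian.Ext.covariant_sequence_exact₃ (ModuleCat.of A Z) hS
    (Abelian.Ext.mk₀ (ModuleCat.ofHom g)) (n₁ := 1) rfl (Subsingleton.elim _ _)
  obtain ⟨e, rfl⟩ := (Abelian.Ext.mk₀_bijective _ _).2 x
  rw [Abelian.Ext.mk₀_comp_mk₀] at hx
  exact ⟨e.hom, congrArg ModuleCat.Hom.hom ((Abelian.Ext.mk₀_bijective _ _).1 hx)⟩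

lemma extZero_of_projective [Module.Projective A P] (n : ℕ) :
    extZero A (n + 1) (ModuleCat.of A P) (ModuleCat.of A Z) := by
  have := (IsProjective.iff_projective (R := A) P).1 inferInstance
  exact (extZero_iff_subsingleton_ext n _ _).2 (Abelian.Ext.subsingleton_of_projective _ _ _)

lemma extZero_of_injective [Module.Injective A P] (n : ℕ) :
    extZero A (n + 1) (ModuleCat.of A Z) (ModuleCat.of A P) := by
  have := Module.injective_object_of_injective_module A P
  exact (extZero_iff_subsingleton_ext n _ _).2 (Abelian.Ext.subsingleton_of_injective _ _ _)

lemma extZero_one_iff_forall_extend [Module.Projective A P] (hi : Function.Injective i)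
    (hex : Function.Exact i p) (hp : Function.Surjective p) :
    extZero A 1 (ModuleCat.of A X) (ModuleCat.of A Z) ↔
      ∀ g : K →ₗ[A] Z, ∃ e : P →ₗ[A] Z, e ∘ₗ i = g := by
  refine ⟨exists_extend_of_extZero hi hex hp, fun h => ?_⟩
  obtain ⟨w, hS⟩ := exists_shortExact_of_exact hi hex hp
  have := (extZero_iff_subsingleton_ext 0 _ _).1
    (extZero_of_projective (A := A) (P := P) (Z := Z) 0)
  refine (extZero_iff_subsingleton_ext 0 _ _).2 (subsingleton_of_forall_eq 0 fun x => ?_)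
  obtain ⟨y, rfl⟩ := Abelian.Ext.contravariant_sequence_exact₃ hS (ModuleCat.of A Z) x
    (Subsingleton.elim _ _) (n₀ := 0) rfl
  obtain ⟨g, rfl⟩ := (Abelian.Ext.mk₀_bijective _ _).2 y
  obtain ⟨e, he⟩ := h g.hom
  have he : g = ModuleCat.ofHom i ≫ ModuleCat.ofHom e := by
    ext x; exact (LinearMap.congr_fun he x).symm
  rw [he, ← Abelian.Ext.mk₀_comp_mk₀, hS.extClass_comp_assoc]

lemma extZero_one_iff_forall_lift [Module.Injective A P] (hi : Function.Injective i)
    (hex : Function.Exact i p) (hp : Function.Surjective p) :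
    extZero A 1 (ModuleCat.of A Z) (ModuleCat.of A K) ↔
      ∀ g : Z →ₗ[A] X, ∃ e : Z →ₗ[A] P, p ∘ₗ e = g := by
  refine ⟨exists_lift_of_extZero hi hex hp, fun h => ?_⟩
  obtain ⟨w, hS⟩ := exists_shortExact_of_exact hi hex hp
  have := (extZero_iff_subsingleton_ext 0 _ _).1 (extZero_of_injective (A := A) (P := P) (Z := Z) 0)
  refine (extZero_iff_subsingleton_ext 0 _ _).2 (subsingleton_of_forall_eq 0 fun x => ?_)
  obtain ⟨y, rfl⟩ := Abelian.Ext.covariant_sequence_exact₁ (ModuleCat.of A Z) hS x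
    (Subsingleton.elim _ _) (n₀ := 0) rfl
  obtain ⟨g, rfl⟩ := (Abelian.Ext.mk₀_bijective _ _).2 y
  obtain ⟨e, he⟩ := h g.hom
  have he : g = ModuleCat.ofHom e ≫ ModuleCat.ofHom p := by
    ext x; exact (LinearMap.congr_fun he x).symm
  rw [he, ← Abelian.Ext.mk₀_comp_mk₀, Abelian.Ext.comp_assoc_of_second_deg_zero, hS.comp_extClass,
    Abelian.Ext.comp_zero]

lemma extZero_succ_iff_syzygy [Module.Projective A P] (hi : Function.Injective i)
    (hex : Function.Exact i p) (hp : Function.Surjective p) (n : ℕ) :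
    extZero A (n + 2) (ModuleCat.of A X) (ModuleCat.of A Z) ↔
      extZero A (n + 1) (ModuleCat.of A K) (ModuleCat.of A Z) := by
  obtain ⟨w, hS⟩ := exists_shortExact_of_exact hi hex hp
  have h1 := (extZero_iff_subsingleton_ext n _ _).1
    (extZero_of_projective (A := A) (P := P) (Z := Z) n)
  have h2 := (extZero_iff_subsingleton_ext (n + 1) _ _).1
    (extZero_of_projective (A := A) (P := P) (Z := Z) (n + 1))
  rw [extZero_iff_subsingleton_ext, extZero_iff_subsingleton_ext]
  constructor <;> intro h <;> refine subsingleton_of_forall_eq 0 fun x => ?_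
  · obtain ⟨y, rfl⟩ := Abelian.Ext.contravariant_sequence_exact₁ hS (ModuleCat.of A Z) x
      (n₁ := n + 1 + 1) (add_comm _ _) (Subsingleton.elim _ _)
    rw [Subsingleton.elim y 0, Abelian.Ext.comp_zero]
  · obtain ⟨y, rfl⟩ := Abelian.Ext.contravariant_sequence_exact₃ hS (ModuleCat.of A Z) x
      (Subsingleton.elim _ _) (n₀ := n + 1) (add_comm _ _)
    rw [Subsingleton.elim y 0, Abelian.Ext.comp_zero]

lemma extZero_succ_iff_cosyzygy [Module.Injective A P] (hi : Function.Injective i)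
    (hex : Function.Exact i p) (hp : Function.Surjective p) (n : ℕ) :
    extZero A (n + 2) (ModuleCat.of A Z) (ModuleCat.of A K) ↔
      extZero A (n + 1) (ModuleCat.of A Z) (ModuleCat.of A X) := by
  obtain ⟨w, hS⟩ := exists_shortExact_of_exact hi hex hp
  have h1 := (extZero_iff_subsingleton_ext n _ _).1
    (extZero_of_injective (A := A) (P := P) (Z := Z) n)
  have h2 := (extZero_iff_subsingleton_ext (n + 1) _ _).1
    (extZero_of_injective (A := A) (P := P) (Z := Z) (n + 1))
  rw [extZero_iff_subsingleton_ext, extZero_iff_subsingleton_ext]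
  constructor <;> intro h <;> refine subsingleton_of_forall_eq 0 fun x => ?_
  · obtain ⟨y, rfl⟩ := Abelian.Ext.covariant_sequence_exact₃ (ModuleCat.of A Z) hS x
      (n₁ := n + 1 + 1) rfl (Subsingleton.elim _ _)
    rw [Subsingleton.elim y 0, Abelian.Ext.zero_comp]
  · obtain ⟨y, rfl⟩ := Abelian.Ext.covariant_sequence_exact₁ (ModuleCat.of A Z) hS x
      (Subsingleton.elim _ _) (n₀ := n + 1) rfl
    rw [Subsingleton.elim y 0, Abelian.Ext.zero_comp]

lemma extZero_middle (hi : Function.Injective i) (hex : Function.Exact i p)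
    (hp : Function.Surjective p) (n : ℕ)
    (hK : extZero A (n + 1) (ModuleCat.of A Z) (ModuleCat.of A K))
    (hX : extZero A (n + 1) (ModuleCat.of A Z) (ModuleCat.of A X)) :
    extZero A (n + 1) (ModuleCat.of A Z) (ModuleCat.of A P) := by
  obtain ⟨w, hS⟩ := exists_shortExact_of_exact hi hex hp
  rw [extZero_iff_subsingleton_ext] at hK hX ⊢
  refine subsingleton_of_forall_eq 0 fun x => ?_
  obtain ⟨y, rfl⟩ := Abelian.Ext.covariant_sequence_exact₂ (ModuleCat.of A Z) hS x
    (Subsingleton.elim _ _)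
  rw [Subsingleton.elim y 0, Abelian.Ext.zero_comp]

lemma extZero_of_retract {n : ℕ} {s : K →ₗ[A] P} {r : P →ₗ[A] K} (hrs : r ∘ₗ s = LinearMap.id)
    (h : extZero A n (ModuleCat.of A Z) (ModuleCat.of A P)) :
    extZero A n (ModuleCat.of A Z) (ModuleCat.of A K) := by
  have hid : ModuleCat.ofHom s ≫ ModuleCat.ofHom r = 𝟙 _ := by
    rw [← ModuleCat.ofHom_comp, hrs]; rfl
  let F := (Ext ℤ (ModuleCat.{0} A) n).obj (Opposite.op (ModuleCat.of A Z))
  have hF : F.map (ModuleCat.ofHom s) ≫ F.map (ModuleCat.ofHom r) = 𝟙 _ := by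
    rw [← F.map_comp, hid, F.map_id]
  unfold extZero at h ⊢
  exact (Function.LeftInverse.injective (f := F.map (ModuleCat.ofHom s))
    (g := F.map (ModuleCat.ofHom r)) fun x => congr($hF x)).subsingleton

end ShortExactSequence

lemma extZero_pi {ι Z : Type} [AddCommGroup Z] [Module A Z] (Y : ι → Type)
    [∀ j, AddCommGroup (Y j)] [∀ j, Module A (Y j)] (n : ℕ)
    (h : ∀ j, extZero A (n + 1) (ModuleCat.of A Z) (ModuleCat.of A (Y j))) :
    extZero A (n + 1) (ModuleCat.of A Z) (ModuleCat.of A ((j : ι) → Y j)) := by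
  induction n generalizing Z with
  | zero =>
    let p : (Z →₀ A) →ₗ[A] Z := Finsupp.linearCombination A id
    have hp : Function.Surjective p := Finsupp.linearCombination_id_surjective A Z
    have hex : Function.Exact (LinearMap.ker p).subtype p := LinearMap.exact_subtype_ker_map p
    rw [extZero_one_iff_forall_extend (Submodule.subtype_injective _) hex hp]
    intro g
    choose e he using fun j => exists_extend_of_extZero (Submodule.subtype_injective _) hex hp (h j)
      (LinearMap.proj j ∘ₗ g)
    refine ⟨LinearMap.pi e, ?_⟩
    ext x j
    exact LinearMap.congr_fun (he j) x
  | succ n ih =>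
    let p : (Z →₀ A) →ₗ[A] Z := Finsupp.linearCombination A id
    have hp : Function.Surjective p := Finsupp.linearCombination_id_surjective A Z
    have hex : Function.Exact (LinearMap.ker p).subtype p := LinearMap.exact_subtype_ker_map p
    rw [extZero_succ_iff_syzygy (Submodule.subtype_injective _) hex hp]
    exact ih fun j => (extZero_succ_iff_syzygy (Submodule.subtype_injective _) hex hp n).1 (h j)

/-- Vanishing of `Ext^n_A(Z, -)` passes to modules in `add Y`. -/
lemma extZero_of_memAdd {Y N Z : ModuleCat.{0} A} (hN : MemAdd A Y N) {n : ℕ}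
    (h : extZero A (n + 1) Z Y) : extZero A (n + 1) Z N := by
  obtain ⟨m, Q, ⟨e⟩⟩ := hN
  refine extZero_of_retract (Z := Z) (s := e.toLinearMap ∘ₗ LinearMap.inl A N Q)
    (r := LinearMap.fst A N Q ∘ₗ e.symm.toLinearMap) (by ext; simp)
    (extZero_pi (Z := Z) (fun _ : Fin m => Y) n fun _ => h)

end ExtVanishing

section SelfInjective

lemma exists_finite_simple_representatives (A : Type) [Ring A] [IsArtinianRing A] :
    ∃ (n : ℕ) (T : Fin n → Submodule A (A ⧸ Module.jacobson A A)),
      (∀ i, IsSimpleModule A (T i)) ∧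
      ∀ (N : Type) [AddCommGroup N] [Module A N] [IsSimpleModule A N],
        ∃ i, Nonempty (N ≃ₗ[A] T i) := by
  have : IsSemisimpleModule A (A ⧸ Module.jacobson A A) :=
    (IsArtinian.isSemisimpleModule_iff_jacobson A _).2 (Module.jacobson_quotient_jacobson A A)
  obtain ⟨n, T, e, hT⟩ :=
    IsSemisimpleModule.exists_linearEquiv_fin_dfinsupp A (A ⧸ Module.jacobson A A)
  refine ⟨n, T, hT, fun N _ _ _ => ?_⟩
  obtain ⟨m, hm, ⟨f⟩⟩ := (isSimpleModule_iff_quot_maximal (R := A) (M := N)).1 inferInstance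
  have hle : Module.jacobson A A ≤ m := Ring.jacobson_le_of_isMaximal m
  let q : (A ⧸ Module.jacobson A A) →ₗ[A] N := f.symm.toLinearMap ∘ₗ Submodule.factor hle
  have hq : Function.Surjective q := f.symm.surjective.comp (Submodule.factor_surjective hle)
  have : Nontrivial N := IsSimpleModule.nontrivial A N
  by_contra! hcon
  have hzero : q ∘ₗ e.symm.toLinearMap = 0 := by
    refine DFinsupp.lhom_ext' fun i => ?_
    have := hT i
    refine (LinearMap.bijective_or_eq_zero _).resolve_left fun hb => ?_
    exact (hcon i).false (LinearEquiv.ofBijective _ hb).symm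
  obtain ⟨x, hx⟩ := exists_ne (0 : N)
  obtain ⟨y, rfl⟩ := hq x
  obtain ⟨z, rfl⟩ := e.symm.surjective y
  exact hx (LinearMap.congr_fun hzero z)

variable (k A : Type) [Field k] [Ring A] [Algebra k A]

/-- For simple `N` and `S`: the right modules `D N` and `Hom_A(S, A)` are both quotients of `A` by
the same right ideal, so that `N` is the Nakayama twist of `S`. -/
def IsNakayamaTwist (N S : Type) [AddCommGroup N] [Module A N] [Module k N]
    [AddCommGroup S] [Module A S] : Prop :=
  ∃ (ξ : N →ₗ[k] k) (s : S →ₗ[A] A), ξ ≠ 0 ∧ Function.Injective s ∧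
    ∀ a : A, (∀ x, ξ (a • x) = 0) ↔ ∀ t, s t * a = 0

variable {k A}

lemma forall_smul_eq_zero_imp {N : Type} [AddCommGroup N] [Module A N] [Module k N]
    [IsScalarTower k A N] [IsSimpleModule A N] {ξ : N →ₗ[k] k} (hξ : ξ ≠ 0) {x : N}
    (h : ∀ a : A, ξ (a • x) = 0) : x = 0 := by
  by_contra hx
  refine hξ (LinearMap.ext fun y => ?_)
  obtain ⟨a, rfl⟩ := IsSimpleModule.toSpanSingleton_surjective A hx y
  exact h a

/-- The `k`-linear map `a ↦ ξ(a • -)`. -/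
@[simps] def smulDual {N : Type} [AddCommGroup N] [Module A N] [Module k N]
    [IsScalarTower k A N] (ξ : N →ₗ[k] k) : A →ₗ[k] Module.Dual k N where
  toFun a := ξ ∘ₗ Algebra.lsmul k k N a
  map_add' a b := by ext; simp
  map_smul' c a := by ext; simp

/-- The usual `k`-linear structure on a dual space, preferred over the structure of `ν_k`. -/
local instance (priority := high) dualModule (V : Type) [AddCommMonoid V] [Module k V] :
    Module k (V →ₗ[k] k) :=
  LinearMap.module

lemma IsNakayamaTwist.nonempty_linearEquiv [Module.Injective A A] [FiniteDimensional k A]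
    {N N' S : Type} [AddCommGroup N] [Module A N] [Module k N] [IsScalarTower k A N]
    [IsSimpleModule A N] [AddCommGroup N'] [Module A N'] [Module k N'] [IsScalarTower k A N']
    [IsSimpleModule A N'] [AddCommGroup S] [Module A S]
    (h : IsNakayamaTwist k A N S) (h' : IsNakayamaTwist k A N' S) : Nonempty (N ≃ₗ[A] N') := by
  have : FiniteDimensional k N := Module.Finite.trans A N
  have : FiniteDimensional k N' := Module.Finite.trans A N'
  have : Nontrivial N := IsSimpleModule.nontrivial A N
  obtain ⟨ξ, s, hξ, hs, hm⟩ := h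
  obtain ⟨ξ', s', hξ', hs', hm'⟩ := h'
  obtain ⟨c', hc'⟩ := Module.Injective.out s hs s'
  let c := c' 1
  have hc (t : S) : s' t = s t * c := by
    rw [← hc', ← smul_eq_mul, ← map_smul, smul_eq_mul, mul_one]
  let η : N →ₗ[k] k := ξ ∘ₗ Algebra.lsmul k k N c
  have hη (a : A) : (∀ x, η (a • x) = 0) ↔ ∀ x, ξ' (a • x) = 0 := by
    rw [hm']
    simp only [hc, mul_assoc, ← hm, mul_smul]
    rfl
  have hη0 : η ≠ 0 := fun h0 => hξ' <| LinearMap.ext fun x => by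
    simpa using (hη 1).1 (by simp [h0]) x
  have hker : LinearMap.ker (smulDual (A := A) η) = LinearMap.ker (smulDual (A := A) ξ') := by
    ext a
    simpa [LinearMap.ext_iff] using hη a
  have hrange : LinearMap.range (smulDual (A := A) η).dualMap =
      LinearMap.range (smulDual (A := A) ξ').dualMap := by
    rw [LinearMap.range_dualMap_eq_dualAnnihilator_ker, hker,
      LinearMap.range_dualMap_eq_dualAnnihilator_ker]
  let graph : Submodule A (N × N') :=
    { carrier := {z | ∀ b : A, η (b • z.1) = ξ' (b • z.2)}
      add_mem' := fun {z w} hz hw b => by simp [hz b, hw b]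
      zero_mem' := fun b => by simp
      smul_mem' := fun a z hz b => by simpa [mul_smul] using hz (b * a) }
  let p₁ : graph →ₗ[A] N := LinearMap.fst A N N' ∘ₗ graph.subtype
  let p₂ : graph →ₗ[A] N' := LinearMap.snd A N N' ∘ₗ graph.subtype
  have h₁ : Function.Injective p₁ := by
    refine (injective_iff_map_eq_zero _).2 fun z hz => ?_
    have hz1 : z.1.1 = 0 := hz
    refine Subtype.ext (Prod.ext hz1 (forall_smul_eq_zero_imp (A := A) hξ' fun a => ?_))
    rw [← z.2 a, hz1, smul_zero, map_zero]
  have h₂ : Function.Injective p₂ := by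
    refine (injective_iff_map_eq_zero _).2 fun z hz => ?_
    have hz1 : z.1.2 = 0 := hz
    refine Subtype.ext (Prod.ext (forall_smul_eq_zero_imp (A := A) hη0 fun a => ?_) hz1)
    rw [z.2 a, hz1, smul_zero, map_zero]
  have hsurj : Function.Surjective p₁ := by
    intro x
    have hx : (smulDual (A := A) η).dualMap (Module.Dual.eval k N x) ∈
        LinearMap.range (smulDual (A := A) ξ').dualMap := hrange ▸ ⟨_, rfl⟩
    obtain ⟨y, hy⟩ := hx
    obtain ⟨x', rfl⟩ := (Module.evalEquiv k N').surjective y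
    exact ⟨⟨(x, x'), fun b => (LinearMap.congr_fun hy b).symm⟩, rfl⟩
  let e := LinearEquiv.ofBijective p₁ ⟨h₁, hsurj⟩
  have hinj : Function.Injective (p₂ ∘ₗ e.symm.toLinearMap) := h₂.comp e.symm.injective
  refine ⟨LinearEquiv.ofBijective (p₂ ∘ₗ e.symm.toLinearMap)
    (LinearMap.bijective_of_ne_zero fun h0 => ?_)⟩
  obtain ⟨x, hx⟩ := exists_ne (0 : N)
  exact hx (hinj (by rw [h0]; rfl))

lemma exists_mul_eq_zero_of_one_notMem [Module.Injective A A] [FiniteDimensional k A]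
    (m : Submodule k A) (hmul : ∀ a ∈ m, ∀ b, a * b ∈ m) (hone : (1 : A) ∉ m) :
    ∃ b : A, b ≠ 0 ∧ ∀ a ∈ m, b * a = 0 := by
  obtain ⟨n, x, hx⟩ := Submodule.fg_iff_exists_fin_generating_family.1 (IsNoetherian.noetherian m)
  let φ : A →ₗ[A] (Fin n → A) := LinearMap.pi fun i => LinearMap.toSpanSingleton A A (x i)
  have hφ : ¬ Function.Injective φ := by
    intro hinj
    obtain ⟨h, hh⟩ := Module.Injective.out φ hinj LinearMap.id
    refine hone ?_
    have h1 : h (φ 1) = 1 := hh 1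
    rw [← h1, LinearMap.pi_apply_eq_sum_univ]
    refine Submodule.sum_mem _ fun i _ => ?_
    simp only [φ, LinearMap.pi_apply, LinearMap.toSpanSingleton_apply, one_mul, smul_eq_mul]
    exact hmul _ (hx ▸ Submodule.subset_span ⟨i, rfl⟩) _
  rw [injective_iff_map_eq_zero] at hφ
  push Not at hφ
  obtain ⟨b, hb, hb0⟩ := hφ
  refine ⟨b, hb0, fun a ha => ?_⟩
  rw [← hx] at ha
  induction ha using Submodule.span_induction with
  | mem y hy => obtain ⟨i, rfl⟩ := hy; exact congrFun hb i
  | zero => simp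
  | add y z _ _ hy hz => rw [mul_add, hy, hz, add_zero]
  | smul c y _ hy => rw [mul_smul_comm, hy, smul_zero]

lemma exists_isNakayamaTwist [Module.Injective A A] [FiniteDimensional k A]
    (N : Type) [AddCommGroup N] [Module A N] [Module k N] [IsScalarTower k A N]
    [IsSimpleModule A N] :
    ∃ S : Submodule A A, IsSimpleModule A S ∧ IsNakayamaTwist k A N S := by
  have : FiniteDimensional k N := Module.Finite.trans A N
  have : IsArtinianRing A := IsArtinianRing.of_finite k A
  have : Nontrivial N := IsSimpleModule.nontrivial A N
  obtain ⟨x₀, hx₀⟩ := exists_ne (0 : N)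
  obtain ⟨ξ, hξx⟩ := Module.Projective.exists_dual_ne_zero k hx₀
  have hξ : ξ ≠ 0 := fun h0 => hξx (by rw [h0]; rfl)
  let m := LinearMap.ker (smulDual (A := A) ξ)
  have hm (a : A) : a ∈ m ↔ ∀ x, ξ (a • x) = 0 := by
    simp [m, LinearMap.ext_iff]
  obtain ⟨b, hb0, hb⟩ := exists_mul_eq_zero_of_one_notMem m
    (fun a ha c => (hm _).2 fun x => by rw [mul_smul]; exact (hm a).1 ha _)
    (fun h1 => hξ <| LinearMap.ext fun x => by simpa using (hm 1).1 h1 x)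
  obtain ⟨S, hS, hSb⟩ := (IsAtomic.eq_bot_or_exists_atom_le (Submodule.span A {b})).resolve_left
    (by simpa using hb0)
  have : IsSimpleModule A S := isSimpleModule_iff_isAtom.2 hS
  refine ⟨S, this, ξ, S.subtype, hξ, S.subtype_injective, fun a => ⟨fun ha t => ?_, fun ha => ?_⟩⟩
  · obtain ⟨c, hc⟩ := Submodule.mem_span_singleton.1 (hSb t.2)
    rw [Submodule.subtype_apply, ← hc, smul_eq_mul, mul_assoc, hb a ((hm a).2 ha), mul_zero]
  · by_contra hcon
    have hker (x : N) (hx : ∀ c : A, ξ ((a * c) • x) = 0) : x = 0 := by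
      by_contra hx0
      refine hcon fun y => ?_
      obtain ⟨c, rfl⟩ := IsSimpleModule.toSpanSingleton_surjective A hx0 y
      simpa [mul_smul] using hx c
    let R : Submodule k (Module.Dual k N) :=
      LinearMap.range (smulDual (A := A) ξ ∘ₗ LinearMap.mulLeft k a)
    have hR : R = ⊤ := by
      have hbot : R.dualCoannihilator = ⊥ := (Submodule.eq_bot_iff _).2 fun x hx =>
        hker x fun c => (Submodule.mem_dualCoannihilator _).1 hx _ ⟨c, rfl⟩
      rw [← Subspace.dualCoannihilator_dualAnnihilator_eq (W := R), hbot,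
        Submodule.dualAnnihilator_bot]
    obtain ⟨c, hc⟩ : ξ ∈ R := hR ▸ Submodule.mem_top
    have hmem : 1 - a * c ∈ m := (hm _).2 fun x => by
      rw [sub_smul, one_smul, map_sub, sub_eq_zero]
      exact (LinearMap.congr_fun hc x).symm
    refine hS.1 ((Submodule.eq_bot_iff _).2 fun t ht => ?_)
    obtain ⟨d, hd⟩ := Submodule.mem_span_singleton.1 (hSb ht)
    have h1 : t * (1 - a * c) = 0 := by rw [← hd, smul_eq_mul, mul_assoc, hb _ hmem, mul_zero]
    have h2 : t * a = 0 := ha ⟨t, ht⟩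
    rwa [mul_sub, mul_one, ← mul_assoc, h2, zero_mul, sub_zero] at h1

lemma IsNakayamaTwist.congr {k A N S S' : Type} [Field k] [Ring A] [AddCommGroup N]
    [Module A N] [Module k N]
    [AddCommGroup S] [Module A S] [AddCommGroup S'] [Module A S'] (e : S' ≃ₗ[A] S)
    (h : IsNakayamaTwist k A N S) : IsNakayamaTwist k A N S' := by
  obtain ⟨ξ, s, hξ, hs, hm⟩ := h
  refine ⟨ξ, s ∘ₗ e.toLinearMap, hξ, hs.comp e.injective, fun a => (hm a).trans ?_⟩
  exact e.symm.toEquiv.forall_congr (by simp)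

/-- Every simple module over a self-injective finite-dimensional algebra embeds in the algebra. -/
lemma exists_injective_of_isSimpleModule (k : Type) {A : Type} [Field k] [Ring A] [Algebra k A]
    [FiniteDimensional k A] [Module.Injective A A]
    (N : Type) [AddCommGroup N] [Module A N] [IsSimpleModule A N] :
    ∃ s : N →ₗ[A] A, Function.Injective s := by
  have : IsArtinianRing A := IsArtinianRing.of_finite k A
  obtain ⟨n, T, hT, hrep⟩ := exists_finite_simple_representatives A
  let r : Setoid (Fin n) :=
    { r := fun i j => Nonempty (T i ≃ₗ[A] T j)
      iseqv := ⟨fun _ => ⟨LinearEquiv.refl _ _⟩, fun ⟨e⟩ => ⟨e.symm⟩, fun ⟨e⟩ ⟨e'⟩ => ⟨e.trans e'⟩⟩ }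
  have htwist (i : Fin n) : ∃ j, IsNakayamaTwist k A (T i) (T j) := by
    obtain ⟨S, hS, hiS⟩ := exists_isNakayamaTwist (k := k) (A := A) (T i)
    obtain ⟨j, ⟨e⟩⟩ := hrep S
    exact ⟨j, hiS.congr e.symm⟩
  choose φ hφ using htwist
  let Φ : Quotient r → Quotient r := fun q => ⟦φ q.out⟧
  have hΦ : Function.Injective Φ := by
    intro q q' h
    obtain ⟨e⟩ := Quotient.exact h
    have := (hφ q.out).nonempty_linearEquiv ((hφ q'.out).congr e)
    rw [← q.out_eq, ← q'.out_eq]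
    exact Quotient.sound this
  obtain ⟨j, ⟨e⟩⟩ := hrep N
  obtain ⟨q, hq⟩ := Finite.surjective_of_injective hΦ ⟦j⟧
  obtain ⟨e'⟩ := Quotient.exact hq
  obtain ⟨-, s, -, hs, -⟩ := hφ q.out
  exact ⟨s ∘ₗ (e.trans e'.symm).toLinearMap, hs.comp (e.trans e'.symm).injective⟩

/-- Every finitely generated module over a self-injective finite-dimensional algebra embeds in a
finitely generated free module. -/
lemma exists_injective_pi_of_finite (k : Type) {A : Type} [Field k] [Ring A] [Algebra k A]
    [FiniteDimensional k A] [Module.Injective A A]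
    (N : Type) [AddCommGroup N] [Module A N] [Module.Finite A N] :
    ∃ (r : ℕ) (s : N →ₗ[A] (Fin r → A)), Function.Injective s := by
  have : IsArtinianRing A := IsArtinianRing.of_finite k A
  obtain ⟨t, ht⟩ := Finset.exists_inf_le (fun φ : N →ₗ[A] A => LinearMap.ker φ)
  have hbot : t.inf (fun φ : N →ₗ[A] A => LinearMap.ker φ) = ⊥ := by
    by_contra hne
    obtain ⟨S, hS, hle⟩ := (IsAtomic.eq_bot_or_exists_atom_le _).resolve_left hne
    have : IsSimpleModule A S := isSimpleModule_iff_isAtom.2 hS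
    obtain ⟨s, hs⟩ := exists_injective_of_isSimpleModule k (A := A) S
    obtain ⟨φ, hφ⟩ := Module.Injective.out S.subtype S.subtype_injective s
    refine hS.1 ((Submodule.eq_bot_iff _).2 fun x hx => ?_)
    have h0 : φ x = 0 := ht φ (hle hx)
    exact congrArg Subtype.val (hs (((hφ ⟨x, hx⟩).symm.trans h0).trans (map_zero s).symm))
  let e := t.equivFin
  refine ⟨t.card, LinearMap.pi fun i => (e.symm i).1, ?_⟩
  refine (injective_iff_map_eq_zero _).2 fun x hx => ?_
  rw [← Submodule.mem_bot A, ← hbot, Submodule.mem_finsetInf]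
  intro φ hφ
  have := congrFun hx (e ⟨φ, hφ⟩)
  simpa using this

/-- A finitely generated projective module over a self-injective ring is injective. -/
lemma injective_of_finite_projective {A : Type} [Ring A] [Module.Injective A A]
    (P : Type) [AddCommGroup P] [Module A P] [Module.Finite A P] [Module.Projective A P] :
    Module.Injective A P := by
  obtain ⟨n, p, s, -, -, hs⟩ := Module.Finite.exists_comp_eq_id_of_projective A P
  exact ⟨fun X Y _ _ _ _ f hf g => by
    choose e he using fun i => Module.Injective.out f hf (LinearMap.proj i ∘ₗ s ∘ₗ g)
    refine ⟨p ∘ₗ LinearMap.pi e, fun x => ?_⟩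
    have h1 : LinearMap.pi e (f x) = s (g x) := funext fun i => he i x
    rw [LinearMap.comp_apply, h1]
    exact LinearMap.congr_fun hs (g x)⟩

/-- The injective envelope of a finitely generated module over a self-injective
finite-dimensional algebra is finitely generated and projective. -/
lemma IsInjEnvelope.finite_projective (k : Type) {A : Type} [Field k] [Ring A] [Algebra k A]
    [FiniteDimensional k A] [Module.Injective A A] {N I : ModuleCat.{0} A} [Module.Finite A N]
    {ι : N ⟶ I} (h : IsInjEnvelope A ι) : Module.Finite A I ∧ Module.Projective A I := by
  have : IsArtinianRing A := IsArtinianRing.of_finite k A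
  obtain ⟨hI, hinj, hess⟩ := h
  obtain ⟨r, s, hs⟩ := exists_injective_pi_of_finite k (A := A) N
  choose e he using fun i => Module.Injective.out ι.hom hinj (LinearMap.proj i ∘ₗ s)
  have he' (x : N) : LinearMap.pi e (ι.hom x) = s x := funext fun i => he i x
  have hker : LinearMap.ker (LinearMap.pi e) = ⊥ := by
    refine hess _ ((Submodule.eq_bot_iff _).2 ?_)
    rintro _ ⟨hx, y, rfl⟩
    have h0 : s y = 0 := (he' y).symm.trans hx
    rw [(injective_iff_map_eq_zero s).1 hs y h0, map_zero]
  have hei : Function.Injective (LinearMap.pi e) := LinearMap.ker_eq_bot.1 hker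
  obtain ⟨q, hq⟩ := Module.Injective.out (LinearMap.pi e) hei LinearMap.id
  exact ⟨Module.Finite.of_injective _ hei,
    Module.Projective.of_split (LinearMap.pi e) q (LinearMap.ext hq)⟩

end SelfInjective

section NakayamaDuality

variable {k A : Type} [Field k] [Ring A] [Algebra k A]

instance (X : Type) [AddCommGroup X] [Module A X] : IsScalarTower k A (NuCarrier k A X) where
  smul_assoc c a φ := by
    refine LinearMap.ext fun h => ?_
    have : rmulHom k A X (c • a) h = c • rmulHom k A X a h := by ext x; simp
    exact (congrArg φ this).trans (map_smul φ c _)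

lemma NuCarrier.smul_apply {X : Type} [AddCommGroup X] [Module A X] (a : A) (φ : NuCarrier k A X)
    (h : X →ₗ[A] A) : (a • φ) h = φ (rmulHom k A X a h) := rfl

variable {P Q R Y Z : Type} [AddCommGroup P] [Module A P] [AddCommGroup Q] [Module A Q]
  [AddCommGroup R] [Module A R]
  [AddCommGroup Y] [Module A Y] [Module k Y] [IsScalarTower k A Y]
  [AddCommGroup Z] [Module A Z] [Module k Z] [IsScalarTower k A Z]

variable (k) in
/-- The action of the Nakayama functor on morphisms. -/
def nuMap (a : P →ₗ[A] Q) : NuCarrier k A P →ₗ[A] NuCarrier k A Q where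
  toFun φ := φ ∘ₗ LinearMap.lcomp k A a
  map_add' _ _ := rfl
  map_smul' _ _ := rfl

lemma nuMap_apply (a : P →ₗ[A] Q) (φ : NuCarrier k A P) (h : Q →ₗ[A] A) :
    nuMap k a φ h = φ (h ∘ₗ a) := rfl

lemma nuMap_injective [Module.Injective A A] {a : P →ₗ[A] Q} (ha : Function.Injective a) :
    Function.Injective (nuMap k a) := by
  refine (injective_iff_map_eq_zero _).2 fun φ hφ => LinearMap.ext fun h => ?_
  obtain ⟨g, hg⟩ := Module.Injective.out a ha h
  have := LinearMap.congr_fun hφ g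
  rwa [nuMap_apply, show g ∘ₗ a = h from LinearMap.ext hg] at this

lemma nuMap_surjective {a : P →ₗ[A] Q} (ha : Function.Surjective a) :
    Function.Surjective (nuMap k a) := by
  intro φ
  obtain ⟨ψ, hψ⟩ := LinearMap.dualMap_surjective_of_injective
    (f := LinearMap.lcomp k A a) (fun g h hgh => LinearMap.ext fun y => by
      obtain ⟨x, rfl⟩ := ha y; exact LinearMap.congr_fun hgh x) φ
  exact ⟨ψ, hψ⟩

lemma nuMap_exact {i : P →ₗ[A] Q} {p : Q →ₗ[A] R} (hex : Function.Exact i p)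
    (hp : Function.Surjective p) : Function.Exact (nuMap k i) (nuMap k p) := by
  intro φ
  constructor
  · intro hφ
    have : φ ∈ LinearMap.range (LinearMap.lcomp k A i).dualMap := by
      rw [LinearMap.range_dualMap_eq_dualAnnihilator_ker, Submodule.mem_dualAnnihilator]
      intro h hh
      have hle : LinearMap.ker p ≤ LinearMap.ker h := by
        intro x hx
        obtain ⟨y, rfl⟩ := (hex x).1 hx
        exact LinearMap.congr_fun (f := h ∘ₗ i) (g := 0) hh y
      let e := p.quotKerEquivOfSurjective hp
      let g : R →ₗ[A] A := (LinearMap.ker p).liftQ h hle ∘ₗ e.symm.toLinearMap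
      have hg : g ∘ₗ p = h := LinearMap.ext fun x => by
        have : e.symm (p x) = Submodule.Quotient.mk x := (LinearEquiv.symm_apply_eq _).2 rfl
        simp [g, this]
      rw [← hg]
      exact LinearMap.congr_fun hφ g
    obtain ⟨ψ, hψ⟩ := this
    exact ⟨ψ, hψ⟩
  · rintro ⟨ψ, rfl⟩
    refine LinearMap.ext fun h => ?_
    rw [nuMap_apply, nuMap_apply, LinearMap.comp_assoc,
      show p ∘ₗ i = 0 from LinearMap.ext hex.apply_apply_eq_zero]
    simp

/-- The canonical map `D Hom_A(P, Y) → Hom_A(Y, ν P)`. -/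
def dualHomToHomNu (l : Module.Dual k (P →ₗ[A] Y)) : Y →ₗ[A] NuCarrier k A P where
  toFun y :=
    { toFun := fun h => l (h.smulRight y)
      map_add' := fun g h => by rw [← map_add]; congr 1; ext; simp [add_smul]
      map_smul' := fun c h => by rw [RingHom.id_apply, ← map_smul]; congr 1; ext; simp }
  map_add' x y := LinearMap.ext fun h => by
    change l _ = l _ + l _
    rw [← map_add]; congr 1; ext; simp
  map_smul' a y := LinearMap.ext fun h => congrArg l (by ext; simp [mul_smul])

lemma nuMap_comp_dualHomToHomNu (a : P →ₗ[A] Q) (l : Module.Dual k (P →ₗ[A] Y)) :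
    nuMap k a ∘ₗ dualHomToHomNu l = dualHomToHomNu (l ∘ₗ LinearMap.lcomp k Y a) := by
  ext y h
  exact congrArg l (by ext; simp)

lemma exists_dual_basis [Module.Finite A P] [Module.Projective A P] :
    ∃ (n : ℕ) (e : Fin n → P) (h : Fin n → P →ₗ[A] A), ∀ x, ∑ i, h i x • e i = x := by
  obtain ⟨n, f, g, -, -, hfg⟩ := Module.Finite.exists_comp_eq_id_of_projective A P
  refine ⟨n, fun i => f (Pi.single i 1), fun i => LinearMap.proj i ∘ₗ g, fun x => ?_⟩
  conv_rhs => rw [← LinearMap.id_apply (R := A) x, ← hfg, LinearMap.comp_apply,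
    LinearMap.pi_apply_eq_sum_univ]
  exact Finset.sum_congr rfl fun i _ =>
    congrArg (fun v => g x i • f v) (funext fun j => by simp [Pi.single_apply, eq_comm])

lemma dualHomToHomNu_bijective [Module.Finite A P] [Module.Projective A P] :
    Function.Bijective (dualHomToHomNu (k := k) (A := A) (P := P) (Y := Y)) := by
  obtain ⟨n, e, h, he⟩ := exists_dual_basis (A := A) (P := P)
  constructor
  · intro l l' hl
    refine LinearMap.ext fun φ => ?_
    have hφ : φ = ∑ i, (h i).smulRight (φ (e i)) := by
      ext x
      conv_lhs => rw [← he x]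
      simp
    have (l : Module.Dual k (P →ₗ[A] Y)) : l φ = ∑ i, dualHomToHomNu l (φ (e i)) (h i) := by
      conv_lhs => rw [hφ]
      rw [map_sum]
      rfl
    rw [this l, this l', hl]
  · intro Φ
    have hk (c : k) (y : Y) : Φ (c • y) = c • Φ y := by
      rw [← algebraMap_smul A c y, map_smul, algebraMap_smul]
    refine ⟨⟨⟨fun φ => ∑ i, Φ (φ (e i)) (h i), fun φ ψ => ?_⟩, fun c φ => ?_⟩, ?_⟩
    · simp [Finset.sum_add_distrib]
    · simp [hk, Finset.mul_sum]
    · ext y g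
      change ∑ i, Φ (g (e i) • y) (h i) = _
      simp_rw [map_smul, NuCarrier.smul_apply]
      rw [← map_sum]
      congr 1
      ext x
      conv_rhs => rw [← he x]
      simp

lemma injective_nuCarrier [Module.Finite A P] [Module.Projective A P] :
    Module.Injective A (NuCarrier k A P) where
  out X Y _ _ _ _ f hf g := by
    let _ := Module.compHom X (algebraMap k A)
    let _ := Module.compHom Y (algebraMap k A)
    have : IsScalarTower k A X := IsScalarTower.of_compHom k A X
    have : IsScalarTower k A Y := IsScalarTower.of_compHom k A Y
    obtain ⟨l, rfl⟩ := dualHomToHomNu_bijective (k := k) (P := P).2 g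
    let F : (P →ₗ[A] X) →ₗ[k] (P →ₗ[A] Y) :=
      { toFun := fun φ => f ∘ₗ φ
        map_add' := fun _ _ => by ext; simp
        map_smul' := fun c φ => by
          ext x
          exact map_smul f (algebraMap k A c) (φ x) }
    obtain ⟨l', hl'⟩ := LinearMap.dualMap_surjective_of_injective (f := F)
      (fun φ ψ h => LinearMap.ext fun x => hf (LinearMap.congr_fun h x)) l
    refine ⟨dualHomToHomNu l', fun x => LinearMap.ext fun h => ?_⟩
    rw [← hl']
    exact congrArg l' (by ext; simp [F])

/-- Auslander–Reiten type duality: for `L ⊂ P` with `P/L = L₁ ⊂ Q` and `Q/L₁ = L₂ ⊂ R`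
(`P`, `Q`, `R` finitely generated projective), `Ext^1(Y, ν L) = 0` iff all maps `L₂ → Y` extend
to `R`. -/
lemma extZero_one_nuCarrier_iff [Module.Injective A A] [Module.Finite A P] [Module.Projective A P]
    [Module.Finite A Q] [Module.Projective A Q] [Module.Finite A R] [Module.Projective A R]
    {L L₁ L₂ : Type} [AddCommGroup L] [Module A L] [AddCommGroup L₁] [Module A L₁]
    [AddCommGroup L₂] [Module A L₂]
    {i : L →ₗ[A] P} {p : P →ₗ[A] L₁} {j : L₁ →ₗ[A] Q} {q : Q →ₗ[A] L₂} {m : L₂ →ₗ[A] R}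
    (hi : Function.Injective i) (hip : Function.Exact i p) (hp : Function.Surjective p)
    (hj : Function.Injective j) (hjq : Function.Exact j q) (hq : Function.Surjective q)
    (hm : Function.Injective m) :
    extZero A 1 (ModuleCat.of A Y) (ModuleCat.of A (NuCarrier k A L)) ↔
      ∀ g : L₂ →ₗ[A] Y, ∃ e : R →ₗ[A] Y, e ∘ₗ m = g := by
  have := injective_nuCarrier (k := k) (A := A) (P := P)
  rw [extZero_one_iff_forall_lift (nuMap_injective (k := k) hi) (nuMap_exact hip hp)
    (nuMap_surjective hp)]
  have hqj : q ∘ₗ j = 0 := LinearMap.ext hjq.apply_apply_eq_zero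
  constructor
  · intro h g
    by_contra hcon
    let U := LinearMap.range (LinearMap.lcomp k Y (m ∘ₗ q))
    have hU : g ∘ₗ q ∉ U := by
      rintro ⟨e, he⟩
      refine hcon ⟨e, LinearMap.ext fun x => ?_⟩
      obtain ⟨x, rfl⟩ := hq x
      exact LinearMap.congr_fun he x
    obtain ⟨l, hl, hlU⟩ := Submodule.exists_dual_map_eq_bot_of_notMem hU inferInstance
    have hmq : nuMap k q ∘ₗ dualHomToHomNu l = 0 := by
      refine LinearMap.ext fun y => nuMap_injective (k := k) hm (LinearMap.ext fun e => ?_)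
      have : e.smulRight y ∘ₗ (m ∘ₗ q) ∈ U := ⟨e.smulRight y, rfl⟩
      have h0 : l (e.smulRight y ∘ₗ (m ∘ₗ q)) = 0 := by
        have := Submodule.mem_map_of_mem (f := l) this
        rwa [hlU, Submodule.mem_bot] at this
      exact (congrArg l (by ext; simp)).trans h0
    have hrange (y : Y) : ∃ z, nuMap k j z = dualHomToHomNu l y :=
      (nuMap_exact (k := k) hjq hq _).1 (LinearMap.congr_fun hmq y)
    let E := LinearEquiv.ofInjective (nuMap k j) (nuMap_injective hj)
    let G : Y →ₗ[A] NuCarrier k A L₁ :=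
      E.symm.toLinearMap ∘ₗ (dualHomToHomNu l).codRestrict (LinearMap.range (nuMap k j)) hrange
    have hG : nuMap k j ∘ₗ G = dualHomToHomNu l := LinearMap.ext fun y =>
      congrArg Subtype.val (E.apply_symm_apply
        ((dualHomToHomNu l).codRestrict (LinearMap.range (nuMap k j)) hrange y))
    obtain ⟨e, he⟩ := h G
    obtain ⟨μ, rfl⟩ := dualHomToHomNu_bijective.2 e
    rw [← he, nuMap_comp_dualHomToHomNu, nuMap_comp_dualHomToHomNu] at hG
    have hlμ := dualHomToHomNu_bijective.1 hG
    refine hl ?_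
    rw [← hlμ]
    have : (g ∘ₗ q) ∘ₗ j = 0 := by rw [LinearMap.comp_assoc, hqj, LinearMap.comp_zero]
    change μ (((g ∘ₗ q) ∘ₗ j) ∘ₗ p) = 0
    rw [this, LinearMap.zero_comp, map_zero]
  · intro h g
    obtain ⟨l, hl⟩ := dualHomToHomNu_bijective.2 (nuMap k j ∘ₗ g)
    have hl0 : l ∘ₗ LinearMap.lcomp k Y (m ∘ₗ q) = 0 := by
      refine dualHomToHomNu_bijective.1 ?_
      rw [← nuMap_comp_dualHomToHomNu, hl]
      ext y e
      change g y (e ∘ₗ m ∘ₗ q ∘ₗ j) = 0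
      rw [hqj, LinearMap.comp_zero, LinearMap.comp_zero, map_zero]
    have hlmem : l ∈ LinearMap.range (LinearMap.lcomp k Y (j ∘ₗ p)).dualMap := by
      rw [LinearMap.range_dualMap_eq_dualAnnihilator_ker, Submodule.mem_dualAnnihilator]
      intro φ hφ
      have hle : LinearMap.ker q ≤ LinearMap.ker φ := by
        intro x hx
        obtain ⟨y, rfl⟩ := (hjq x).1 hx
        obtain ⟨z, rfl⟩ := hp y
        exact LinearMap.congr_fun (f := φ ∘ₗ j ∘ₗ p) (g := 0) hφ z
      let E := q.quotKerEquivOfSurjective hq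
      obtain ⟨e, he⟩ := h ((LinearMap.ker q).liftQ φ hle ∘ₗ E.symm.toLinearMap)
      have hφe : e ∘ₗ m ∘ₗ q = φ := by
        rw [← LinearMap.comp_assoc, he]
        ext x
        have : E.symm (q x) = Submodule.Quotient.mk x := (LinearEquiv.symm_apply_eq _).2 rfl
        simp [this]
      rw [← hφe]
      exact LinearMap.congr_fun hl0 e
    obtain ⟨μ, rfl⟩ := hlmem
    refine ⟨dualHomToHomNu μ, LinearMap.ext fun y => nuMap_injective (k := k) hj ?_⟩
    rw [← LinearMap.comp_apply (nuMap k j) g, ← hl]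
    rfl

end NakayamaDuality

section Coresolution

/-- Short exact sequences `0 → C n → J n → C (n + 1) → 0` with `J n` finitely
generated projective. -/
structure CosyzygyData {A : Type} [Ring A] (C : ℕ → ModuleCat.{0} A) where
  /-- the middle terms -/
  J : ℕ → ModuleCat.{0} A
  /-- the inclusions -/
  i : ∀ n, C n →ₗ[A] J n
  /-- the projections -/
  p : ∀ n, J n →ₗ[A] C (n + 1)
  inj : ∀ n, Function.Injective (i n)
  exact : ∀ n, Function.Exact (i n) (p n)
  surj : ∀ n, Function.Surjective (p n)
  finite : ∀ n, Module.Finite A (J n)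
  projective : ∀ n, Module.Projective A (J n)

attribute [instance] CosyzygyData.finite CosyzygyData.projective

lemma IsMinInjCoresolution.finite_cosyzygy (k : Type) {A : Type} [Field k] [Ring A] [Algebra k A]
    [FiniteDimensional k A] [Module.Injective A A] {M : ModuleCat.{0} A} [Module.Finite A M]
    {C : ℕ → ModuleCat.{0} A} (hC : IsMinInjCoresolution A M C) (n : ℕ) :
    Module.Finite A (C n) := by
  induction n with
  | zero =>
    obtain ⟨⟨e⟩, -⟩ := hC
    exact Module.Finite.equiv e.toLinearEquiv.symm
  | succ n ih =>
    obtain ⟨I, ι, p, hι, hp, -⟩ := hC.2 n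
    have := (hι.finite_projective k).1
    exact Module.Finite.of_surjective p.hom hp

lemma IsMinInjCoresolution.nonempty_cosyzygyData (k : Type) {A : Type} [Field k] [Ring A]
    [Algebra k A] [FiniteDimensional k A] [Module.Injective A A] {M : ModuleCat.{0} A}
    [Module.Finite A M] {C : ℕ → ModuleCat.{0} A} (hC : IsMinInjCoresolution A M C) :
    Nonempty (CosyzygyData C) := by
  have hfin := hC.finite_cosyzygy k
  choose J ι p hι hp hex using hC.2
  exact ⟨J, fun n => (ι n).hom, fun n => (p n).hom, fun n => (hι n).2.1,
    fun n => LinearMap.exact_iff.2 (hex n).symm, hp, fun n => ((hι n).finite_projective k).1,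
    fun n => ((hι n).finite_projective k).2⟩

lemma memAdd_refl {A : Type} [Ring A] (X : ModuleCat.{0} A) : MemAdd A X X :=
  ⟨1, ModuleCat.of A PUnit, ⟨(LinearEquiv.prodUnique (R := A) (M := X) (M₂ := PUnit)).trans
    (LinearEquiv.funUnique (Fin 1) A X).symm⟩⟩

lemma nuMap_comp_nuMap_of_iso {k A : Type} [Field k] [Ring A] [Algebra k A] {N M : ModuleCat.{0} A}
    (e : N ≅ M) : nuMap k e.inv.hom ∘ₗ nuMap k e.hom.hom = LinearMap.id := by
  ext φ h
  rw [LinearMap.comp_apply, nuMap_apply, nuMap_apply]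
  congr 1
  ext
  simp

lemma extZero_iff_extZero_nuCarrier (k : Type) {A : Type} [Field k] [Ring A] [Algebra k A]
    {N M : ModuleCat.{0} A} (e : N ≅ M) (hM : NakayamaStable k A M) (Y : ModuleCat.{0} A) (n : ℕ) :
    extZero A (n + 1) Y M ↔ extZero A (n + 1) Y (ModuleCat.of A (NuCarrier k A N)) :=
  ⟨fun h => extZero_of_retract (Z := Y) (nuMap_comp_nuMap_of_iso e)
      (extZero_of_memAdd ((hM (NuMod k A M)).2 (memAdd_refl _)) h),
    fun h => extZero_of_memAdd ((hM M).1 (memAdd_refl M))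
      (extZero_of_retract (Z := Y) (nuMap_comp_nuMap_of_iso e.symm) h)⟩

namespace CosyzygyData

variable {A : Type} [Ring A] {C : ℕ → ModuleCat.{0} A}

lemma injective (D : CosyzygyData C) [Module.Injective A A] (n : ℕ) : Module.Injective A (D.J n) :=
  injective_of_finite_projective _

lemma extZero_cosyzygy (D : CosyzygyData C) [Module.Injective A A] {Z : ModuleCat.{0} A}
    (h : ∀ n, extZero A (n + 1) Z (C 0)) (j n : ℕ) : extZero A (n + 1) Z (C j) := by
  induction j generalizing n with
  | zero => exact h n
  | succ j ih =>
    have := D.injective j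
    exact (extZero_succ_iff_cosyzygy (Z := Z) (D.inj j) (D.exact j) (D.surj j) n).1 (ih (n + 1))

variable (k : Type) [Field k] [Algebra k A]

lemma extZero_nuCarrier_iff (D : CosyzygyData C) [Module.Injective A A]
    (Y : ModuleCat.{0} A) (m n : ℕ) :
    extZero A (m + 1) Y (ModuleCat.of A (NuCarrier k A (C n))) ↔
      extZero A 1 Y (ModuleCat.of A (NuCarrier k A (C (n + m)))) := by
  induction m generalizing n with
  | zero => rfl
  | succ m ih =>
    have := injective_nuCarrier (k := k) (A := A) (P := D.J n)
    have h := extZero_succ_iff_cosyzygy (Z := Y) (nuMap_injective (k := k) (D.inj n))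
      (nuMap_exact (D.exact n) (D.surj n)) (nuMap_surjective (D.surj n)) m
    refine h.trans ((ih (n + 1)).trans ?_)
    rw [Nat.add_right_comm, Nat.add_assoc]

/-- For the cosyzygies of a Nakayama-stable module `M`, `Ext^n(Y, M)` vanishes for all `n ≥ 1` iff
maps to `Y` extend along the inclusions `C j → J j` for `j ≥ 2`. -/
lemma forall_extZero_iff_forall_extend (D : CosyzygyData C) [Module.Injective A A]
    {M : ModuleCat.{0} A} (e : C 0 ≅ M)
    (hM : NakayamaStable k A M) (Y : ModuleCat.{0} A) :
    (∀ n, extZero A (n + 1) Y M) ↔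
      ∀ j, ∀ g : C (j + 2) →ₗ[A] Y, ∃ h : D.J (j + 2) →ₗ[A] Y, h ∘ₗ D.i (j + 2) = g := by
  let _ := Module.compHom Y (algebraMap k A)
  have : IsScalarTower k A Y := IsScalarTower.of_compHom k A Y
  refine forall_congr' fun n => ?_
  rw [extZero_iff_extZero_nuCarrier k e hM, D.extZero_nuCarrier_iff k, Nat.zero_add]
  exact extZero_one_nuCarrier_iff (Y := Y) (D.inj n) (D.exact n) (D.surj n) (D.inj (n + 1))
    (D.exact (n + 1)) (D.surj (n + 1)) (D.inj (n + 2))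

/-- If the second cosyzygy has no extensions by a Nakayama-stable module `M`, then `M` is
projective. -/
lemma projective_of_extZero_one (D : CosyzygyData C) [Module.Injective A A]
    {M : ModuleCat.{0} A} (e : C 0 ≅ M)
    (hM : NakayamaStable k A M) (h : extZero A 1 (C 2) M) : Module.Projective A M := by
  have hstep (n : ℕ) (hn : Module.Projective A (C (n + 1))) : Module.Projective A (C n) := by
    obtain ⟨s, hs⟩ := Module.projective_lifting_property (D.p n) LinearMap.id (D.surj n)
    have hr (x : D.J n) : x - s (D.p n x) ∈ LinearMap.range (D.i n) := by
      refine (D.exact n _).1 ?_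
      have := LinearMap.congr_fun hs (D.p n x)
      rw [map_sub, sub_eq_zero]
      exact this.symm
    let E := LinearEquiv.ofInjective (D.i n) (D.inj n)
    let r := E.symm.toLinearMap ∘ₗ (LinearMap.id - s ∘ₗ D.p n).codRestrict _ hr
    refine Module.Projective.of_split (D.i n) r (LinearMap.ext fun x => ?_)
    refine (LinearEquiv.symm_apply_eq E).2 (Subtype.ext ?_)
    change D.i n x - s (D.p n (D.i n x)) = D.i n x
    rw [(D.exact n).apply_apply_eq_zero, map_zero, sub_zero]
  have h2 : Module.Projective A (C 2) := by
    let _ := Module.compHom (C 2) (algebraMap k A)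
    have : IsScalarTower k A (C 2) := IsScalarTower.of_compHom k A (C 2)
    obtain ⟨r, hr⟩ := (extZero_one_nuCarrier_iff (k := k) (Y := C 2) (D.inj 0) (D.exact 0)
      (D.surj 0) (D.inj 1) (D.exact 1) (D.surj 1) (D.inj 2)).1
      ((extZero_iff_extZero_nuCarrier k e hM _ 0).1 h) LinearMap.id
    exact Module.Projective.of_split (D.i 2) r hr
  have := hstep 0 (hstep 1 h2)
  exact Module.Projective.of_equiv e.toLinearEquiv

end CosyzygyData

end Coresolution

section Filtered

variable {A : Type} [Ring A]

/-- Modules with a finite filtration whose subquotients are finite products of the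
`C j` with `j ≥ 1`. -/
inductive CosyzygyFiltered (C : ℕ → ModuleCat.{0} A) : ModuleCat.{0} A → Prop
  | zero (X : ModuleCat.{0} A) (hX : Subsingleton X) : CosyzygyFiltered C X
  | step (K X : ModuleCat.{0} A) (i : K →ₗ[A] X) (ι : Type) (hι : Finite ι) (T : ι → ℕ)
      (p : X →ₗ[A] ((t : ι) → C (T t + 1))) (hi : Function.Injective i) (hex : Function.Exact i p)
      (hp : Function.Surjective p) (hK : CosyzygyFiltered C K) : CosyzygyFiltered C X

variable {C : ℕ → ModuleCat.{0} A}

lemma CosyzygyFiltered.cosyzygy (n : ℕ) : CosyzygyFiltered C (C (n + 1)) := by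
  refine .step (ModuleCat.of A PUnit) _ 0 Unit inferInstance (fun _ => n)
    (LinearMap.pi fun _ => LinearMap.id) (Function.injective_of_subsingleton _) ?_ ?_
    (.zero _ (inferInstanceAs (Subsingleton PUnit)))
  · intro x
    constructor
    · intro hx
      exact ⟨0, (congrFun hx ()).symm⟩
    · rintro ⟨y, rfl⟩
      rfl
  · exact fun y => ⟨y (), rfl⟩

lemma CosyzygyFiltered.finite (hC : ∀ n, Module.Finite A (C n)) {X : ModuleCat.{0} A}
    (hX : CosyzygyFiltered C X) : Module.Finite A X := by
  induction hX with
  | zero X hX => exact inferInstance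
  | step K X i ι hι T p hi hex hp hK ih =>
    exact Module.Finite.of_exact hex hp

lemma CosyzygyFiltered.extZero_right {Z : ModuleCat.{0} A} {n : ℕ}
    (hC : ∀ j, extZero A (n + 1) Z (C (j + 1))) {X : ModuleCat.{0} A}
    (hX : CosyzygyFiltered C X) : extZero A (n + 1) Z X := by
  induction hX with
  | zero X hX =>
    have : Module.Injective A X := ⟨fun _ _ _ _ _ _ _ _ _ => ⟨0, fun _ => Subsingleton.elim _ _⟩⟩
    exact extZero_of_injective (P := X) (Z := Z) n
  | step K X i ι hι T p hi hex hp hK ih =>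
    exact extZero_middle (Z := Z) hi hex hp n ih
      (extZero_pi (Z := Z) (fun t => C (T t + 1)) n fun t => hC (T t))

lemma projective_pi {ι : Type} [Finite ι] (P : ι → Type) [∀ t, AddCommGroup (P t)]
    [∀ t, Module A (P t)] [∀ t, Module.Projective A (P t)] :
    Module.Projective A ((t : ι) → P t) := by
  classical
  have := Fintype.ofFinite ι
  exact Module.Projective.of_equiv (DFinsupp.linearEquivFunOnFintype (R := A) (M := P))

/-- `g` factors through a finitely generated projective module. -/
def FactorsThroughFinProj {W X : Type} [AddCommGroup W] [Module A W] [AddCommGroup X] [Module A X]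
    (g : W →ₗ[A] X) : Prop :=
  ∃ (P : ModuleCat.{0} A) (a : W →ₗ[A] P) (b : P →ₗ[A] X),
    Module.Finite A P ∧ Module.Projective A P ∧ b ∘ₗ a = g

lemma FactorsThroughFinProj.pi {W ι : Type} [AddCommGroup W] [Module A W] [Finite ι]
    {X : ι → Type} [∀ t, AddCommGroup (X t)] [∀ t, Module A (X t)] {g : W →ₗ[A] ((t : ι) → X t)}
    (h : ∀ t, FactorsThroughFinProj (LinearMap.proj t ∘ₗ g)) : FactorsThroughFinProj g := by
  choose P a b hf hp hab using h
  refine ⟨ModuleCat.of A ((t : ι) → P t), LinearMap.pi a,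
    LinearMap.pi fun t => b t ∘ₗ LinearMap.proj t, Module.Finite.pi, projective_pi _, ?_⟩
  ext x t
  exact LinearMap.congr_fun (hab t) x

lemma CosyzygyFiltered.factorsThroughFinProj (D : CosyzygyData C) {W : ModuleCat.{0} A}
    (hW : ∀ j, extZero A 1 W (C j)) {X : ModuleCat.{0} A}
    (hX : CosyzygyFiltered C X) (g : W →ₗ[A] X) : FactorsThroughFinProj g := by
  induction hX with
  | zero X hX =>
    exact ⟨ModuleCat.of A PUnit, 0, 0, inferInstanceAs (Module.Finite A PUnit),
      inferInstanceAs (Module.Projective A PUnit), LinearMap.ext fun x => Subsingleton.elim _ _⟩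
  | step K X i ι hι T p hi hex hp hK ih =>
    obtain ⟨P, a, b, hPf, hPp, hab⟩ : FactorsThroughFinProj (p ∘ₗ g) := by
      refine FactorsThroughFinProj.pi fun t => ?_
      obtain ⟨e, he⟩ := exists_lift_of_extZero (Z := W) (D.inj (T t)) (D.exact (T t))
        (D.surj (T t)) (hW _) (LinearMap.proj t ∘ₗ p ∘ₗ g)
      exact ⟨D.J (T t), e, D.p (T t), inferInstance, inferInstance, he⟩
    obtain ⟨b', hb'⟩ := Module.projective_lifting_property p b hp
    have hr (x : W) : g x - b' (a x) ∈ LinearMap.range i := by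
      refine (hex _).1 ?_
      rw [map_sub, sub_eq_zero, ← LinearMap.comp_apply p b', hb']
      exact (LinearMap.congr_fun hab x).symm
    let E := LinearEquiv.ofInjective i hi
    obtain ⟨P', a', c, hPf', hPp', hac⟩ :=
      ih (E.symm.toLinearMap ∘ₗ (g - b' ∘ₗ a).codRestrict _ hr)
    refine ⟨ModuleCat.of A (P × P'), a.prod a', b'.coprod (i ∘ₗ c),
      inferInstanceAs (Module.Finite A (P × P')), inferInstanceAs (Module.Projective A (P × P')),
      LinearMap.ext fun x => ?_⟩
    have h1 : i (c (a' x)) = g x - b' (a x) := by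
      have h2 : c (a' x) = E.symm ((g - b' ∘ₗ a).codRestrict _ hr x) := LinearMap.congr_fun hac x
      rw [h2]
      exact congrArg Subtype.val (E.apply_symm_apply ((g - b' ∘ₗ a).codRestrict _ hr x))
    change b' (a x) + i (c (a' x)) = g x
    rw [h1, add_sub_cancel]

lemma IsFinSumFrom.of_surjective {X Q : Type} [AddCommGroup X] [Module A X] [AddCommGroup Q]
    [Module A Q] {G G' H H' : Submodule A X} (hG : G = G') (hH : H = H') (π : G' →ₗ[A] Q)
    (hπ : Function.Surjective π) (hker : LinearMap.ker π = Submodule.comap G'.subtype H')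
    (hQ : IsFinSumFrom A C Q) :
    IsFinSumFrom A C (G ⧸ Submodule.comap G.subtype H) := by
  subst hG hH
  obtain ⟨m, T, ⟨e⟩⟩ := hQ
  exact ⟨m, T, ⟨((Submodule.quotEquivOfEq _ _ hker.symm).trans
    (π.quotKerEquivOfSurjective hπ)).trans e⟩⟩

lemma IsFinSumFrom.of_subsingleton {Q : Type} [AddCommGroup Q] [Module A Q] [Subsingleton Q] :
    IsFinSumFrom A C Q :=
  ⟨0, Fin.elim0, ⟨LinearEquiv.ofBijective 0
    ⟨Function.injective_of_subsingleton _, fun _ => ⟨0, Subsingleton.elim _ _⟩⟩⟩⟩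

lemma IsFinSumFrom.pi {ι : Type} [Finite ι] (T : ι → ℕ) :
    IsFinSumFrom A C ((t : ι) → C (T t)) := by
  have := Fintype.ofFinite ι
  let e := Fintype.equivFin ι
  exact ⟨Fintype.card ι, fun t => some (T (e.symm t)),
    ⟨(LinearEquiv.piCongrLeft A (fun t => C (T t)) e.symm).symm⟩⟩

lemma FinMFiltered.of_exact {K X : ModuleCat.{0} A} {Q : Type} [AddCommGroup Q] [Module A Q]
    {i : K →ₗ[A] X} {p : X →ₗ[A] Q} (hi : Function.Injective i) (hex : Function.Exact i p)
    (hp : Function.Surjective p) (hQ : IsFinSumFrom A C Q) (hK : FinMFiltered A C K) :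
    FinMFiltered A C X := by
  obtain ⟨F, hmono, h0, ⟨N, hN⟩, hF⟩ := hK
  have hmap (n : ℕ) (hn : n ≤ N) : (if n ≤ N then (F n).map i else ⊤) = (F n).map i := if_pos hn
  have htop (n : ℕ) (hn : ¬ n ≤ N) : (if n ≤ N then (F n).map i else ⊤) = ⊤ := if_neg hn
  refine ⟨fun n => if n ≤ N then (F n).map i else ⊤, ?_, ?_, ⟨N + 1, htop _ (by omega)⟩, ?_⟩
  · intro m n hmn
    by_cases hn : n ≤ N
    · simp only [hn, hmn.trans hn, if_true]
      exact Submodule.map_mono (hmono hmn)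
    · simp only [hn, if_false, le_top]
  · simp [h0]
  · intro n
    rcases lt_trichotomy n N with hn | rfl | hn
    · let E := Submodule.equivMapOfInjective i hi (F (n + 1))
      refine IsFinSumFrom.of_surjective (hmap (n + 1) hn) (hmap n hn.le)
        (Submodule.mkQ (Submodule.comap (F (n + 1)).subtype (F n)) ∘ₗ E.symm.toLinearMap)
        ((Submodule.mkQ_surjective _).comp E.symm.surjective) ?_ (hF n)
      ext x
      obtain ⟨y, rfl⟩ := E.surjective x
      have hy : (E y : X) = i y := Submodule.coe_equivMapOfInjective_apply i hi _ y
      simp [hy, hi.eq_iff]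
    · refine IsFinSumFrom.of_surjective (htop (n + 1) (by omega)) (hmap n le_rfl)
        (p ∘ₗ Submodule.subtype ⊤) (fun y => ?_) ?_ hQ
      · obtain ⟨x, rfl⟩ := hp y
        exact ⟨⟨x, trivial⟩, rfl⟩
      · ext x
        simpa [hN] using hex x
    · refine IsFinSumFrom.of_surjective (htop (n + 1) (by omega)) (htop n (by omega))
        (0 : _ →ₗ[A] PUnit) (fun _ => ⟨0, rfl⟩) (by simp) IsFinSumFrom.of_subsingleton

lemma CosyzygyFiltered.finMFiltered {X : ModuleCat.{0} A} (hX : CosyzygyFiltered C X) :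
    FinMFiltered A C X := by
  induction hX with
  | zero X hX =>
    refine ⟨fun _ => ⊥, monotone_const, rfl, ⟨0, Subsingleton.elim _ _⟩, fun _ => ?_⟩
    exact IsFinSumFrom.of_subsingleton
  | step K X i ι hι T p hi hex hp hK ih =>
    exact ih.of_exact hi hex hp (IsFinSumFrom.pi fun t => T t + 1)

end Filtered

section Pushout

variable {A : Type} [Ring A]

lemma exists_pushout {B E Q X : Type} [AddCommGroup B] [Module A B] [AddCommGroup E] [Module A E]
    [AddCommGroup Q] [Module A Q] [AddCommGroup X] [Module A X] {i : B →ₗ[A] E} {p : E →ₗ[A] Q}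
    (hi : Function.Injective i) (hex : Function.Exact i p) (hp : Function.Surjective p)
    (u : B →ₗ[A] X) :
    ∃ (X' : ModuleCat.{0} A) (s : X →ₗ[A] X') (e : E →ₗ[A] X') (q : X' →ₗ[A] Q),
      Function.Injective s ∧ Function.Exact s q ∧ Function.Surjective q ∧ e ∘ₗ i = s ∘ₗ u ∧
      ∀ (V : ModuleCat.{0} A) (x : X →ₗ[A] V) (y : E →ₗ[A] V), y ∘ₗ i = x ∘ₗ u →
        ∃ z : X' →ₗ[A] V, z ∘ₗ s = x := by
  let U := LinearMap.range (u.prod (-i))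
  have hmem (b : B) : (u b, -i b) ∈ U := ⟨b, rfl⟩
  have hpi (b : B) : p (i b) = 0 := hex.apply_apply_eq_zero b
  let q : ((X × E) ⧸ U) →ₗ[A] Q := U.liftQ (p ∘ₗ LinearMap.snd A X E) (by
    rintro _ ⟨b, rfl⟩
    simp [hpi])
  have hq (x : X) (y : E) : q (U.mkQ (x, y)) = p y := rfl
  refine ⟨ModuleCat.of A ((X × E) ⧸ U), U.mkQ ∘ₗ LinearMap.inl A X E, U.mkQ ∘ₗ LinearMap.inr A X E,
    q, ?_, ?_, ?_, ?_, ?_⟩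
  · refine (injective_iff_map_eq_zero _).2 fun x hx => ?_
    obtain ⟨b, hb⟩ := (Submodule.Quotient.mk_eq_zero U).1 hx
    obtain ⟨h1, h2⟩ := Prod.ext_iff.1 hb
    have hb0 : b = 0 := hi (by simpa using h2)
    simpa [hb0] using h1.symm
  · intro z
    obtain ⟨⟨x, y⟩, rfl⟩ := U.mkQ_surjective z
    constructor
    · intro h
      obtain ⟨b, rfl⟩ := (hex y).1 h
      refine ⟨x + u b, ?_⟩
      refine (Submodule.Quotient.eq U).2 ⟨b, ?_⟩
      ext <;> simp
    · rintro ⟨x', hx'⟩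
      rw [← hx']
      exact map_zero p
  · intro z
    obtain ⟨y, rfl⟩ := hp z
    exact ⟨U.mkQ (0, y), rfl⟩
  · refine LinearMap.ext fun b => ?_
    refine ((Submodule.Quotient.eq U).2 ⟨b, ?_⟩).symm
    ext <;> simp
  · intro V x y hxy
    refine ⟨U.liftQ (x.coprod y) ?_, LinearMap.ext fun b => ?_⟩
    · rintro _ ⟨b, rfl⟩
      have : y (i b) = x (u b) := LinearMap.congr_fun hxy b
      simp [this]
    · change x b + y 0 = x b
      simp

lemma exists_span_hom (k : Type) [Field k] [Algebra k A] [FiniteDimensional k A]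
    (N X : Type) [AddCommGroup N] [Module A N] [Module.Finite A N] [AddCommGroup X] [Module A X]
    [Module.Finite A X] :
    ∃ (r : ℕ) (u : Fin r → N →ₗ[A] X), ∀ g : N →ₗ[A] X, ∃ c : Fin r → k,
      ∀ x, g x = ∑ t, algebraMap k A (c t) • u t x := by
  let _ := Module.compHom N (algebraMap k A)
  let _ := Module.compHom X (algebraMap k A)
  have : IsScalarTower k A N := IsScalarTower.of_compHom k A N
  have : IsScalarTower k A X := IsScalarTower.of_compHom k A X
  have : FiniteDimensional k N := Module.Finite.trans A N
  have : FiniteDimensional k X := Module.Finite.trans A X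
  have : FiniteDimensional k (N →ₗ[A] X) := Module.Finite.of_injective
    (LinearMap.restrictScalarsₗ k A N X k) (LinearMap.restrictScalars_injective k)
  obtain ⟨r, u, hu⟩ := Module.Finite.exists_fin (R := k) (M := N →ₗ[A] X)
  refine ⟨r, u, fun g => ?_⟩
  obtain ⟨c, hc⟩ := (Submodule.mem_span_range_iff_exists_fun k).1
    (hu ▸ Submodule.mem_top : g ∈ Submodule.span k (Set.range u))
  refine ⟨c, fun x => ?_⟩
  rw [← hc]
  simp only [LinearMap.sum_apply, LinearMap.smul_apply, algebraMap_smul]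

/-- Multiplying a linear map by a scalar from the base field. -/
def baseSMul {k : Type} [Field k] [Algebra k A] {N X : Type} [AddCommGroup N] [Module A N]
    [AddCommGroup X] [Module A X] (c : k) (g : N →ₗ[A] X) : N →ₗ[A] X where
  toFun x := algebraMap k A c • g x
  map_add' x y := by simp
  map_smul' a x := by
    rw [map_smul, smul_smul, smul_smul, Algebra.commutes, RingHom.id_apply]

variable {C : ℕ → ModuleCat.{0} A}

/-- Every module filtered by cosyzygies embeds into another one so that all maps from `C j`,
`2 ≤ j ≤ m + 2`, extend along `C j → J j`. -/
lemma CosyzygyFiltered.exists_extension (k : Type) [Field k] [Algebra k A] [FiniteDimensional k A]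
    (D : CosyzygyData C) (hC : ∀ n, Module.Finite A (C n)) {X : ModuleCat.{0} A}
    (hX : CosyzygyFiltered C X) (m : ℕ) :
    ∃ (X' : ModuleCat.{0} A) (s : X →ₗ[A] X'), CosyzygyFiltered C X' ∧ Function.Injective s ∧
      (∀ j < m, ∀ g : C (j + 2) →ₗ[A] X,
        ∃ e : D.J (j + 2) →ₗ[A] X', e ∘ₗ D.i (j + 2) = s ∘ₗ g) ∧
      ∀ V : ModuleCat.{0} A,
        (∀ j, ∀ g : C (j + 2) →ₗ[A] V, ∃ e : D.J (j + 2) →ₗ[A] V, e ∘ₗ D.i (j + 2) = g) →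
        ∀ x : X →ₗ[A] V, ∃ z : X' →ₗ[A] V, z ∘ₗ s = x := by
  classical
  have := hX.finite hC
  choose r u hu using fun j : ℕ => exists_span_hom (A := A) k (C (j + 2)) X
  let ι := (j : Fin m) × Fin (r j)
  let i : ((t : ι) → C (t.1 + 2)) →ₗ[A] ((t : ι) → D.J (t.1 + 2)) :=
    LinearMap.pi fun t => D.i (t.1 + 2) ∘ₗ LinearMap.proj t
  let p : ((t : ι) → D.J (t.1 + 2)) →ₗ[A] ((t : ι) → C (t.1 + 2 + 1)) :=
    LinearMap.pi fun t => D.p (t.1 + 2) ∘ₗ LinearMap.proj t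
  let U : ((t : ι) → C (t.1 + 2)) →ₗ[A] X := ∑ t : ι, u t.1 t.2 ∘ₗ LinearMap.proj t
  have hi : Function.Injective i := fun x y h => funext fun t => D.inj _ (congrFun h t)
  have hex : Function.Exact i p := by
    intro y
    constructor
    · intro hy
      choose x hx using fun t : ι => (D.exact _ (y t)).1 (congrFun hy t)
      exact ⟨x, funext hx⟩
    · rintro ⟨x, rfl⟩
      exact funext fun t => (D.exact _).apply_apply_eq_zero _
  have hp : Function.Surjective p := by
    intro y
    choose x hx using fun t : ι => D.surj _ (y t)
    exact ⟨x, funext hx⟩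
  have hU (t : ι) (c : C (t.1 + 2)) : U (LinearMap.single A _ t c) = u t.1 t.2 c := by
    simp only [U, LinearMap.sum_apply, LinearMap.comp_apply, LinearMap.proj_apply]
    rw [Finset.sum_eq_single t]
    · simp
    · intro t' _ hne
      simp [Pi.single_eq_of_ne hne]
    · simp
  have hi_single (t : ι) (c : C (t.1 + 2)) :
      i (LinearMap.single A _ t c) = LinearMap.single A _ t (D.i (t.1 + 2) c) := by
    ext t'
    by_cases h : t' = t
    · subst h; simp [i]
    · simp [i, Pi.single_eq_of_ne h]
  obtain ⟨X', s, e, q, hs, hsq, hq, hes, huniv⟩ := exists_pushout hi hex hp U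
  refine ⟨X', s, .step X X' s ι inferInstance (fun t => t.1 + 2) q hs hsq hq hX, hs, ?_, ?_⟩
  · intro j hj g
    obtain ⟨c, hc⟩ := hu j g
    let t (l : Fin (r j)) : ι := ⟨⟨j, hj⟩, l⟩
    refine ⟨∑ l, baseSMul (c l) (e ∘ₗ LinearMap.single A (fun t : ι => D.J (t.1 + 2)) (t l)), ?_⟩
    ext x
    rw [LinearMap.comp_apply, LinearMap.comp_apply, hc, map_sum, LinearMap.sum_apply]
    refine Finset.sum_congr rfl fun l _ => ?_
    change algebraMap k A (c l) • e (LinearMap.single A _ (t l) (D.i (j + 2) x)) = _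
    have h1 := hi_single (t l) x
    have h2 := hU (t l) x
    have h3 := LinearMap.congr_fun hes (LinearMap.single A _ (t l) x)
    rw [LinearMap.comp_apply, LinearMap.comp_apply, h1, h2] at h3
    rw [map_smul]
    exact congrArg _ h3
  · intro V hV x
    choose y hy using fun t : ι => hV t.1 (x ∘ₗ u t.1 t.2)
    refine huniv V x (∑ t : ι, y t ∘ₗ LinearMap.proj t) (LinearMap.ext fun c => ?_)
    simp only [LinearMap.sum_apply, LinearMap.comp_apply, U, map_sum]
    exact Finset.sum_congr rfl fun t _ => LinearMap.congr_fun (hy t) (c t)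

/-- The chain `C 1 = X 0 ⊂ X 1 ⊂ ⋯` obtained by iterated extensions. -/
lemma exists_cosyzygyFiltered_chain (k : Type) [Field k] [Algebra k A] [FiniteDimensional k A]
    (D : CosyzygyData C) (hC : ∀ n, Module.Finite A (C n)) :
    ∃ (X : ℕ → ModuleCat.{0} A) (s : ∀ n, X n →ₗ[A] X (n + 1)) (_ : C 1 ≃ₗ[A] X 0),
      (∀ n, CosyzygyFiltered C (X n)) ∧ (∀ n, Function.Injective (s n)) ∧
      (∀ n, ∀ j < n, ∀ g : C (j + 2) →ₗ[A] X n,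
        ∃ e : D.J (j + 2) →ₗ[A] X (n + 1), e ∘ₗ D.i (j + 2) = s n ∘ₗ g) ∧
      ∀ n, ∀ V : ModuleCat.{0} A,
        (∀ j, ∀ g : C (j + 2) →ₗ[A] V, ∃ e : D.J (j + 2) →ₗ[A] V, e ∘ₗ D.i (j + 2) = g) →
        ∀ x : X n →ₗ[A] V, ∃ z : X (n + 1) →ₗ[A] V, z ∘ₗ s n = x := by
  choose next s hf hs he hu using fun (X : {X : ModuleCat.{0} A // CosyzygyFiltered C X}) (m : ℕ) =>
    X.2.exists_extension k D hC m
  let X : ℕ → {X : ModuleCat.{0} A // CosyzygyFiltered C X} := fun n =>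
    Nat.rec ⟨C 1, .cosyzygy 0⟩ (fun m Y => ⟨next Y m, hf Y m⟩) n
  exact ⟨fun n => (X n).1, fun n => s (X n) n, LinearEquiv.refl _ _, fun n => (X n).2,
    fun n => hs (X n) n,
    fun n => he (X n) n, fun n => hu (X n) n⟩

end Pushout

section Telescope

open scoped DirectSum

variable {A : Type} [Ring A] {X : ℕ → Type} [∀ n, AddCommGroup (X n)] [∀ n, Module A (X n)]

/-- The endomorphism `id - shift` of `⨁ X n` whose cokernel is the colimit of the chain `s`. -/
noncomputable def telescopeMap (s : ∀ n, X n →ₗ[A] X (n + 1)) : (⨁ n, X n) →ₗ[A] ⨁ n, X n :=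
  LinearMap.id - DirectSum.toModule A ℕ _ fun n => DirectSum.lof A ℕ X (n + 1) ∘ₗ s n

/-- The colimit of the chain `s`. -/
abbrev Telescope (s : ∀ n, X n →ₗ[A] X (n + 1)) : Type :=
  (⨁ n, X n) ⧸ LinearMap.range (telescopeMap s)

namespace Telescope

variable (s : ∀ n, X n →ₗ[A] X (n + 1))

lemma telescopeMap_of (n : ℕ) (x : X n) : telescopeMap s (DirectSum.of X n x) =
    DirectSum.of X n x - DirectSum.of X (n + 1) (s n x) := by
  refine congrArg (DirectSum.of X n x - ·) ?_
  exact DirectSum.toModule_lof A n x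

lemma telescopeMap_apply_zero (z : ⨁ n, X n) : telescopeMap s z 0 = z 0 := by
  induction z using DirectSum.induction_on with
  | zero => simp
  | of n x =>
    rw [telescopeMap_of, DirectSum.sub_apply, DirectSum.of_eq_of_ne (n + 1) 0 _ (by simp), sub_zero]
  | add x y hx hy => rw [map_add, DirectSum.add_apply, hx, hy, DirectSum.add_apply]

lemma telescopeMap_apply_succ (z : ⨁ n, X n) (m : ℕ) :
    telescopeMap s z (m + 1) = z (m + 1) - s m (z m) := by
  induction z using DirectSum.induction_on with
  | zero => simp
  | of n x =>
    rw [telescopeMap_of, DirectSum.sub_apply]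
    congr 1
    by_cases h : n = m
    · subst h
      rw [DirectSum.of_eq_same, DirectSum.of_eq_same]
    · rw [DirectSum.of_eq_of_ne (n + 1) (m + 1) _ (by omega),
        DirectSum.of_eq_of_ne n m _ (by omega), map_zero]
  | add x y hx hy =>
    rw [map_add, DirectSum.add_apply, hx, hy, DirectSum.add_apply, DirectSum.add_apply, map_add]
    abel

lemma telescopeMap_injective : Function.Injective (telescopeMap s) := by
  refine (injective_iff_map_eq_zero _).2 fun z hz => ?_
  have h (n : ℕ) : z n = 0 := by
    induction n with
    | zero => rw [← telescopeMap_apply_zero s, hz, DirectSum.zero_apply]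
    | succ n ih =>
      have := telescopeMap_apply_succ s z n
      rwa [hz, ih, map_zero, sub_zero, DirectSum.zero_apply, eq_comm] at this
  exact DFinsupp.ext h

/-- The structure map `X n → colim X`. -/
noncomputable def incl (n : ℕ) : X n →ₗ[A] Telescope s :=
  Submodule.mkQ _ ∘ₗ DirectSum.lof A ℕ X n

lemma incl_succ (n : ℕ) : incl s (n + 1) ∘ₗ s n = incl s n := by
  refine LinearMap.ext fun x => ?_
  exact ((Submodule.Quotient.eq (LinearMap.range (telescopeMap s))).2
    ⟨DirectSum.of X n x, telescopeMap_of s n x⟩).symm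

lemma range_incl_mono : Monotone fun n => LinearMap.range (incl s n) := by
  refine monotone_nat_of_le_succ fun n => ?_
  rw [← incl_succ s n]
  exact LinearMap.range_comp_le_range _ _

lemma iSup_range_incl : ⨆ n, LinearMap.range (incl s n) = ⊤ := by
  refine eq_top_iff.2 fun w _ => ?_
  obtain ⟨z, rfl⟩ := Submodule.mkQ_surjective _ w
  induction z using DirectSum.induction_on with
  | zero => rw [map_zero]; exact zero_mem _
  | of n x => exact Submodule.mem_iSup_of_mem n ⟨x, rfl⟩
  | add x y hx hy => rw [map_add]; exact add_mem (hx trivial) (hy trivial)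

variable {s}

lemma incl_injective (hs : ∀ n, Function.Injective (s n)) (n : ℕ) :
    Function.Injective (incl s n) := by
  classical
  refine (injective_iff_map_eq_zero _).2 fun x hx => ?_
  obtain ⟨z, hz⟩ := (Submodule.Quotient.mk_eq_zero _).1 hx
  have hlt : ∀ m < n, z m = 0 := by
    intro m hm
    induction m with
    | zero =>
      rw [← telescopeMap_apply_zero s, hz]
      exact DirectSum.of_eq_of_ne n 0 _ (by omega)
    | succ m ih =>
      have := telescopeMap_apply_succ s z m
      rw [ih (by omega), map_zero, sub_zero, hz] at this
      rw [← this]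
      exact DirectSum.of_eq_of_ne n (m + 1) _ (by omega)
  have hn : z n = x := by
    have hx : telescopeMap s z n = x := by rw [hz]; exact DirectSum.of_eq_same n x
    cases n with
    | zero => rwa [telescopeMap_apply_zero] at hx
    | succ n => rwa [telescopeMap_apply_succ, hlt n (by omega), map_zero, sub_zero] at hx
  have hgt (m : ℕ) (hm : n ≤ m) (h0 : z (m + 1) = 0) : z m = 0 := by
    have := telescopeMap_apply_succ s z m
    rw [h0, hz, zero_sub] at this
    have h1 : DirectSum.lof A ℕ X n x (m + 1) = 0 := DirectSum.of_eq_of_ne n (m + 1) _ (by omega)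
    rw [h1, eq_comm, neg_eq_zero] at this
    exact (injective_iff_map_eq_zero _).1 (hs m) _ this
  obtain ⟨N, hN⟩ : ∃ N, n + N ∉ DFinsupp.support z := by
    by_contra! h
    exact Set.infinite_of_injective_forall_mem (add_right_injective n) h (Finset.finite_toSet _)
  rw [DFinsupp.notMem_support_iff] at hN
  induction N with
  | zero => exact hn.symm.trans hN
  | succ N ih => exact ih (hgt (n + N) (by omega) hN)

/-- Maps from finitely generated modules to the colimit factor through some stage. -/
lemma exists_factor_of_finite (hs : ∀ n, Function.Injective (s n)) {N : Type} [AddCommGroup N]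
    [Module A N] [Module.Finite A N] (g : N →ₗ[A] Telescope s) (m : ℕ) :
    ∃ (n : ℕ) (_ : m < n) (g' : N →ₗ[A] X n), incl s n ∘ₗ g' = g := by
  obtain ⟨n, hn⟩ : ∃ n, LinearMap.range g ≤ LinearMap.range (incl s n) := by
    have hcomp := (Submodule.fg_iff_compact (LinearMap.range g)).1
      (Module.Finite.iff_fg.1 inferInstance)
    obtain ⟨_, ⟨n, rfl⟩, hn⟩ :=
      (CompleteLattice.isCompactElement_iff_le_of_directed_sSup_le _ _).1 hcomp
        (Set.range fun n => LinearMap.range (incl s n)) (Set.range_nonempty _)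
        (range_incl_mono s).directed_le.directedOn_range
        (by rw [sSup_range, iSup_range_incl]; exact le_top)
    exact ⟨n, hn⟩
  have hle : LinearMap.range g ≤ LinearMap.range (incl s (max n (m + 1))) :=
    hn.trans (range_incl_mono s (le_max_left _ _))
  let E := LinearEquiv.ofInjective _ (incl_injective hs (max n (m + 1)))
  let g₀ := g.codRestrict (LinearMap.range (incl s (max n (m + 1)))) fun x => hle ⟨x, rfl⟩
  exact ⟨max n (m + 1), by omega, E.symm.toLinearMap ∘ₗ g₀, LinearMap.ext fun x =>
    congrArg Subtype.val (E.apply_symm_apply (g₀ x))⟩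

/-- A map out of the first stage extends to the colimit if maps extend along each inclusion. -/
lemma exists_desc {V : Type} [AddCommGroup V] [Module A V]
    (h : ∀ n, ∀ x : X n →ₗ[A] V, ∃ z : X (n + 1) →ₗ[A] V, z ∘ₗ s n = x) (x : X 0 →ₗ[A] V) :
    ∃ z : Telescope s →ₗ[A] V, z ∘ₗ incl s 0 = x := by
  choose next hnext using h
  let y : ∀ n, X n →ₗ[A] V := fun n => Nat.rec x (fun m w => next m w) n
  have hy (n : ℕ) : y (n + 1) ∘ₗ s n = y n := hnext n (y n)
  refine ⟨Submodule.liftQ _ (DirectSum.toModule A ℕ V y) ?_, LinearMap.ext fun v => ?_⟩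
  · rw [LinearMap.range_le_ker_iff]
    refine DirectSum.linearMap_ext A fun n => LinearMap.ext fun v => ?_
    have := LinearMap.congr_fun (hy n) v
    simp only [telescopeMap, LinearMap.comp_apply, LinearMap.sub_apply, LinearMap.id_apply,
      DirectSum.toModule_lof, map_sub, LinearMap.zero_apply, sub_eq_zero]
    exact this.symm
  · exact DirectSum.toModule_lof A 0 v

/-- `Ext^n(N, -)` of a finitely generated module vanishes on the colimit if it vanishes on all
stages. -/
lemma extZero_of_forall [IsNoetherianRing A] (hs : ∀ n, Function.Injective (s n)) (n : ℕ) {N : Type}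
    [AddCommGroup N] [Module A N] [Module.Finite A N]
    (h : ∀ m, extZero A (n + 1) (ModuleCat.of A N) (ModuleCat.of A (X m))) :
    extZero A (n + 1) (ModuleCat.of A N) (ModuleCat.of A (Telescope s)) := by
  obtain ⟨r, p, hp⟩ := Module.Finite.exists_fin' A N
  have hex : Function.Exact (LinearMap.ker p).subtype p := LinearMap.exact_subtype_ker_map p
  have hi : Function.Injective (LinearMap.ker p).subtype := Submodule.subtype_injective _
  induction n generalizing N r with
  | zero =>
    rw [extZero_one_iff_forall_extend hi hex hp]
    intro g
    obtain ⟨m, -, g', rfl⟩ := exists_factor_of_finite hs g 0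
    obtain ⟨e, rfl⟩ := exists_extend_of_extZero hi hex hp (h m) g'
    exact ⟨incl s m ∘ₗ e, rfl⟩
  | succ n ih =>
    rw [extZero_succ_iff_syzygy hi hex hp]
    obtain ⟨r', p', hp'⟩ := Module.Finite.exists_fin' A (LinearMap.ker p)
    exact ih (fun m => (extZero_succ_iff_syzygy hi hex hp n).1 (h m)) r' p' hp'
      (LinearMap.exact_subtype_ker_map p') (Submodule.subtype_injective _)

end Telescope

/-- The image of a finitely generated module in `⨁ X n` lies in a finite partial sum: the map is
fixed by a truncation, which factors through a finite product. -/
lemma exists_truncation {N : Type} [AddCommGroup N] [Module A N] [Module.Finite A N]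
    (g : N →ₗ[A] ⨁ n, X n) :
    ∃ (m : ℕ) (τ : (⨁ n, X n) →ₗ[A] ((t : Fin m) → X t))
      (σ : ((t : Fin m) → X t) →ₗ[A] ⨁ n, X n), σ ∘ₗ τ ∘ₗ g = g := by
  classical
  obtain ⟨r, v, hv⟩ := Module.Finite.exists_fin (R := A) (M := N)
  let F : Finset ℕ := Finset.univ.biUnion fun j => DFinsupp.support (g (v j))
  let m := F.sup id + 1
  have hm (j : Fin r) (n : ℕ) (hn : m ≤ n) : g (v j) n = 0 := by
    by_contra hne
    have : n ∈ F := Finset.mem_biUnion.2 ⟨j, Finset.mem_univ _, DFinsupp.mem_support_iff.2 hne⟩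
    have := Finset.le_sup (f := id) this
    simp only [id] at this
    omega
  let τ : (⨁ n, X n) →ₗ[A] ((t : Fin m) → X t) := LinearMap.pi fun t => DirectSum.component A ℕ X t
  let σ : ((t : Fin m) → X t) →ₗ[A] ⨁ n, X n :=
    ∑ t : Fin m, DirectSum.lof A ℕ X t ∘ₗ LinearMap.proj t
  refine ⟨m, τ, σ, LinearMap.ext_on_range (v := v) hv fun j => DFinsupp.ext fun n => ?_⟩
  have h1 : (σ ∘ₗ τ ∘ₗ g) (v j) = ∑ t : Fin m, DirectSum.of X t (g (v j) t) := by
    simp only [σ, LinearMap.comp_apply, LinearMap.sum_apply]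
    rfl
  rw [h1]
  change DirectSum.component A ℕ X n _ = _
  rw [map_sum]
  by_cases hn : n < m
  · rw [Finset.sum_eq_single ⟨n, hn⟩]
    · exact DirectSum.of_eq_same n _
    · intro t _ ht
      exact DirectSum.of_eq_of_ne _ _ _ fun h => ht (Fin.ext h.symm)
    · simp
  · rw [hm j n (by omega)]
    refine Finset.sum_eq_zero fun t _ => ?_
    exact DirectSum.of_eq_of_ne _ _ _ (by omega)

end Telescope

section Main
variable {A : Type} [Ring A]

lemma extZero_of_iso {n : ℕ} {Z Y N : ModuleCat.{0} A} (e : Y ≅ N) (h : extZero A n Z Y) :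
    extZero A n Z N :=
  extZero_of_retract (Z := Z) (s := e.toLinearEquiv.symm.toLinearMap)
    (r := e.toLinearEquiv.toLinearMap)
    (LinearMap.ext fun x => e.toLinearEquiv.apply_symm_apply x) h

/-- A left minimal map out of the first cosyzygy of a projective module has zero target. -/
lemma IsMinInjCoresolution.subsingleton_of_projective (k : Type) [Field k] [Algebra k A]
    [FiniteDimensional k A] [Module.Injective A A] {M : ModuleCat.{0} A} [Module.Finite A M]
    {C : ℕ → ModuleCat.{0} A} (hC : IsMinInjCoresolution A M C) (hM : Module.Projective A M)
    {W : ModuleCat.{0} A} {f : C 1 ⟶ W} (hf : LeftMinimal A f) : Subsingleton W := by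
  obtain ⟨e⟩ := hC.1
  have := hC.finite_cosyzygy k 0
  have : Module.Projective A (C 0) := Module.Projective.of_equiv e.toLinearEquiv.symm
  have hinj : Module.Injective A (C 0) := injective_of_finite_projective (C 0)
  obtain ⟨I, ι, p, ⟨-, hι, hess⟩, hp, hex⟩ := hC.2 0
  obtain ⟨r, hr⟩ := hinj.out ι.hom hι LinearMap.id
  have hker : LinearMap.ker r = ⊥ := by
    refine hess _ (eq_bot_iff.2 ?_)
    rintro _ ⟨hx, y, rfl⟩
    have hy : y = 0 := (hr y).symm.trans hx
    rw [hy, map_zero]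
    exact zero_mem _
  have hsurj (x : I) : p x = 0 := by
    have hx : ι.hom (r x) = x := LinearMap.ker_eq_bot.1 hker (hr (r x))
    exact hex.le ⟨r x, hx⟩
  have hC1 (y : C 1) : y = 0 := by
    obtain ⟨x, rfl⟩ := hp y
    exact hsurj x
  have h0 := hf 0 (by
    ext y
    rw [hC1 y, map_zero, map_zero])
  exact ⟨fun x y => h0.1 rfl⟩

/-- If `Ext^1(W, -)` vanishes on the direct sum of the stages of a chain, then a map into `W`
from a finitely generated module which factors through the colimit of the chain
factors through a finitely generated projective module. -/
lemma exists_factor_through_projective {C : ℕ → ModuleCat.{0} A} (D : CosyzygyData C)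
    {W : ModuleCat.{0} A} (hW : ∀ j, extZero A 1 W (C j)) {X : ℕ → ModuleCat.{0} A}
    (hX : ∀ n, CosyzygyFiltered C (X n)) (s : ∀ n, X n →ₗ[A] X (n + 1))
    (hsum : extZero A 1 W (ModuleCat.of A (DirectSum ℕ fun n => X n)))
    {N : Type} [AddCommGroup N] [Module A N] [Module.Finite A N] (f : N →ₗ[A] W)
    (a : W →ₗ[A] Telescope s) (b : Telescope s →ₗ[A] W) (hab : b ∘ₗ a ∘ₗ f = f) :
    FactorsThroughFinProj f := by
  obtain ⟨a, rfl⟩ := exists_lift_of_extZero (Z := W) (Telescope.telescopeMap_injective s)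
    (LinearMap.exact_map_mkQ_range _) (Submodule.mkQ_surjective _) hsum a
  obtain ⟨m, τ, σ, hσ⟩ := exists_truncation (a ∘ₗ f)
  obtain ⟨P, g, h, hfin, hproj, hgh⟩ := FactorsThroughFinProj.pi (g := τ ∘ₗ a) fun t =>
    (hX t).factorsThroughFinProj D hW (LinearMap.proj t ∘ₗ τ ∘ₗ a)
  refine ⟨P, g ∘ₗ f, b ∘ₗ Submodule.mkQ _ ∘ₗ σ ∘ₗ h, hfin, hproj, LinearMap.ext fun x => ?_⟩
  have h1 : h (g (f x)) = τ (a (f x)) := LinearMap.congr_fun hgh (f x)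
  have h2 : σ (τ (a (f x))) = a (f x) := LinearMap.congr_fun hσ x
  have h3 := LinearMap.congr_fun hab x
  simp only [LinearMap.comp_apply] at h3 ⊢
  rw [h1, h2, h3]

end Main

open Limits in
/-- **Theorem 1.2, (1) ⇔ (5)**. With `C` the cosyzygy sequence of `M` along a minimal
injective coresolution (`C 1 = Ω_A^{-1}(M)`) and `f : C 1 ⟶ W` a minimal left
`𝒢`-approximation, `M` is projective iff the class `{Z ∣ Ext_A^1(W,Z) = 0}` is closed
under countable direct sums of finitely `M`-filtered modules. -/
theorem tachikawa_second_conjecture_iff_ext_closed_under_countable_sums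
    (k A : Type) [Field k] [Ring A] [Algebra k A] [FiniteDimensional k A]
    [Module.Injective A A]
    (M : ModuleCat.{0} A) [Module.Finite A ↥M]
    (hgen : IsGen A M) (hso : SelfOrthogonal A M) (hns : NakayamaStable k A M)
    (C : ℕ → ModuleCat.{0} A) (hC : IsMinInjCoresolution A M C)
    (W : ModuleCat.{0} A) (f : C 1 ⟶ W)
    (happrox : IsLeftGApprox A M f) (hmin : LeftMinimal A f) :
    Module.Projective A ↥M ↔
      ∀ Z : ℕ → ModuleCat.{0} A, (∀ n, FinMFiltered A C (Z n)) →
        (∀ n, extZero A 1 W (Z n)) → extZero A 1 W (∐ Z) := by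
  obtain ⟨e⟩ := hC.1
  refine ⟨fun hM Z _ _ => ?_, fun hsum => ?_⟩
  · have := hC.subsingleton_of_projective k hM hmin
    have : Module.Projective A W := ⟨⟨0, fun _ => Subsingleton.elim _ _⟩⟩
    exact extZero_of_projective (P := W) (Z := ↥(∐ Z)) 0
  obtain ⟨D⟩ := hC.nonempty_cosyzygyData k
  have hfin (n : ℕ) : Module.Finite A (C n) := hC.finite_cosyzygy k n
  have hW : ∀ j, extZero A 1 W (C j) := fun j =>
    D.extZero_cosyzygy (fun n => extZero_of_iso e.symm (happrox.1 (n + 1) (by omega)).2) j 0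
  have hMC : ∀ j n, extZero A (n + 1) M (C j) :=
    D.extZero_cosyzygy fun n => extZero_of_iso e.symm (hso (n + 1) (by omega))
  obtain ⟨X, s, e₀, hX, hs, hext, hdesc⟩ := exists_cosyzygyFiltered_chain k D hfin
  have hXsum : extZero A 1 W (ModuleCat.of A (DirectSum ℕ fun n => X n)) :=
    extZero_of_iso (ModuleCat.coprodIsoDirectSum X)
      (hsum X (fun n => (hX n).finMFiltered) fun n => (hX n).extZero_right fun j => hW (j + 1))
  have : IsNoetherianRing A := IsNoetherianRing.of_finite k A
  have hT : MemG A M (ModuleCat.of A (Telescope s)) := by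
    have hTM := (D.forall_extZero_iff_forall_extend k e hns (ModuleCat.of A (Telescope s))).2
      fun j g => by
        obtain ⟨n, hn, g', rfl⟩ := Telescope.exists_factor_of_finite hs g j
        obtain ⟨x, hx⟩ := hext n j hn g'
        refine ⟨Telescope.incl s (n + 1) ∘ₗ x, ?_⟩
        rw [LinearMap.comp_assoc, hx, ← LinearMap.comp_assoc, Telescope.incl_succ]
    intro n hn
    obtain ⟨n, rfl⟩ := Nat.exists_eq_add_of_le' hn
    exact ⟨Telescope.extZero_of_forall (N := M) hs n fun m =>
      (hX m).extZero_right fun j => hMC (j + 1) n, hTM n⟩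
  obtain ⟨b, hb⟩ := Telescope.exists_desc (s := s) (V := W)
    (fun n => hdesc n W ((D.forall_extZero_iff_forall_extend k e hns W).1
      fun n => (happrox.1 (n + 1) (by omega)).2)) (f.hom ∘ₗ e₀.symm.toLinearMap)
  obtain ⟨a, ha⟩ := happrox.2 _ hT (ModuleCat.ofHom (Telescope.incl s 0 ∘ₗ e₀.toLinearMap))
  have hba : b ∘ₗ a.hom ∘ₗ f.hom = f.hom := by
    refine LinearMap.ext fun x => ?_
    have h1 : Telescope.incl s 0 (e₀ x) = a.hom (f.hom x) :=
      LinearMap.congr_fun (congrArg ModuleCat.Hom.hom ha) x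
    have h2 := LinearMap.congr_fun hb (e₀ x)
    simp only [LinearMap.comp_apply, LinearEquiv.coe_coe, LinearEquiv.symm_apply_apply] at h2 ⊢
    rw [← h1, h2]
  obtain ⟨P, g, h, _, _, hgh⟩ :=
    exists_factor_through_projective D hW hX s hXsum f.hom a.hom b hba
  obtain ⟨E, hE⟩ := (injective_of_finite_projective P).out (D.i 1) (D.inj 1) g
  refine D.projective_of_extZero_one k e hns
    ((extZero_one_iff_forall_extend (Z := M) (D.inj 1) (D.exact 1) (D.surj 1)).2 fun u => ?_)
  obtain ⟨v, hv⟩ := happrox.2 M (fun n hn => ⟨hso n hn, hso n hn⟩) (ModuleCat.ofHom u)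
  refine ⟨v.hom ∘ₗ h ∘ₗ E, LinearMap.ext fun x => ?_⟩
  have h1 : u x = v.hom (f.hom x) := LinearMap.congr_fun (congrArg ModuleCat.Hom.hom hv) x
  have h2 : h (g x) = f.hom x := LinearMap.congr_fun hgh x
  simp only [LinearMap.comp_apply]
  rw [hE, h2, h1]
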